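/- arXiv:1310.1860 — 3 statements merged into one kernel-verified Lean document; each statement's English description precedes it below -/
import Mathlib

section
/- Let q ∈ (1,2) ∪ (2,∞) and let (G,p) be a finite bar-joint framework in (ℝ^d,‖·‖_q) such that p_{v,i} ≠ p_{w,i} for every edge vw ∈ E(G) and every coordinate i ∈ {1,…,d}. Then the following are equivalent: (i) (G,p) is continuously rigid and regular; (ii) (G,p) is infinitesimally rigid. -/
open Asymptotics Filter Topology Set

open scoped Classical

noncomputable section

namespace RigidityPaper

variable {V X E : Type}

/-- `p` is a placement of the graph `G`: adjacent vertices are placed at distinct points. -/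
def IsPlacement (G : SimpleGraph V) (p : V → X) : Prop :=
  ∀ ⦃v w⦄, G.Adj v w → p v ≠ p w

section NormedSpace

variable [NormedAddCommGroup X] [NormedSpace ℝ X]

/-- `u` is an infinitesimal flex of the framework `(G,p)` in the normed space `X`. -/
def IsFlex (G : SimpleGraph V) (p u : V → X) : Prop :=
  ∀ ⦃v w⦄, G.Adj v w →
    (fun t : ℝ => ‖(p v + t • u v) - (p w + t • u w)‖ - ‖p v - p w‖)
      =o[𝓝 (0 : ℝ)] (fun t : ℝ => t)

/-- A continuous rigid motion of the normed space `X`. -/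
def IsContRigidMotion (Γ : X → ℝ → X) : Prop :=
  (∀ t ∈ Icc (-1 : ℝ) 1, Isometry (fun x => Γ x t)) ∧
    (∀ x, ContinuousOn (Γ x) (Icc (-1 : ℝ) 1)) ∧ ∀ x, Γ x 0 = x

/-- An infinitesimal rigid motion of the normed space `X`. -/
def IsInfRigidMotion (γ : X → X) : Prop :=
  ∃ Γ, IsContRigidMotion Γ ∧ ∀ x, HasDerivWithinAt (Γ x) (γ x) (Icc (-1 : ℝ) 1) 0

/-- `u` is a trivial (infinitesimal) flex on the vertex set `S`. -/
def IsTrivialOn (p : V → X) (S : Set V) (u : V → X) : Prop :=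
  ∃ γ, IsInfRigidMotion γ ∧ ∀ v ∈ S, u v = γ (p v)

/-- The framework `(G,p)` is infinitesimally rigid. -/
def InfRigid (G : SimpleGraph V) (p : V → X) : Prop :=
  ∀ u, IsFlex G p u → IsTrivialOn p univ u

end NormedSpace

/-- A tower of finite subgraphs of `G`. -/
structure Tower (G : SimpleGraph V) where
  seq : ℕ → G.Subgraph
  mono : ∀ k, seq k ≤ seq (k + 1)
  finite : ∀ k, (seq k).verts.Finite

variable {G : SimpleGraph V}

/-- A tower is vertex-complete if its vertex sets exhaust the vertices of `G`. -/
def VertexComplete (T : Tower G) : Prop := (⋃ k, (T.seq k).verts) = univ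

/-- A tower is edge-complete if its edges exhaust the edges of `G`. -/
def EdgeComplete (T : Tower G) : Prop := ∀ ⦃v w⦄, G.Adj v w → ∃ k, (T.seq k).Adj v w

section NormedSpace

variable [NormedAddCommGroup X] [NormedSpace ℝ X]

/-- The flex cancellation property of a tower of frameworks: every non-trivial
infinitesimal flex of the `k`-th framework fails to extend to some later framework. -/
def FlexCancel (T : Tower G) (p : V → X) : Prop :=
  ∀ k u, IsFlex (T.seq k).spanningCoe p u → ¬ IsTrivialOn p (T.seq k).verts u →
    ∃ m, k < m ∧
      ¬ ∃ u', IsFlex (T.seq m).spanningCoe p u' ∧ ∀ v ∈ (T.seq k).verts, u' v = u v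

/-- A tower of frameworks is relatively infinitesimally rigid: no non-trivial
infinitesimal flex of the `k`-th framework extends to the `(k+1)`-st framework. -/
def RelRigidTower (T : Tower G) (p : V → X) : Prop :=
  ∀ k u, IsFlex (T.seq k).spanningCoe p u →
    (∃ u', IsFlex (T.seq (k + 1)).spanningCoe p u' ∧ ∀ v ∈ (T.seq k).verts, u' v = u v) →
    IsTrivialOn p (T.seq k).verts u

/-- The subframework on the subgraph `H` is infinitesimally rigid. -/
def SubInfRigid (H : G.Subgraph) (p : V → X) : Prop :=
  ∀ u, IsFlex H.spanningCoe p u → IsTrivialOn p H.verts u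

/-- The framework `(G,p)` is sequentially infinitesimally rigid. -/
def SeqInfRigid (G : SimpleGraph V) (p : V → X) : Prop :=
  ∃ T : Tower G, VertexComplete T ∧ ∀ k, SubInfRigid (T.seq k) p

end NormedSpace

/-! ### The `ℓ^q` norms on `ℝ^d` -/

/-- The `ℓ^q` norm on `ℝ^d`. -/
def qnorm (q : ℝ) {d : ℕ} (x : Fin d → ℝ) : ℝ := (∑ i, |x i| ^ q) ^ (1 / q)

/-- `u` is an infinitesimal flex of `(G,p)` in `(ℝ^d, ‖·‖_q)`. -/
def IsQFlex (q : ℝ) {d : ℕ} (G : SimpleGraph V) (p u : V → Fin d → ℝ) : Prop :=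
  ∀ ⦃v w⦄, G.Adj v w →
    (fun t : ℝ => qnorm q ((p v + t • u v) - (p w + t • u w)) - qnorm q (p v - p w))
      =o[𝓝 (0 : ℝ)] (fun t : ℝ => t)

/-- A continuous rigid motion of `(ℝ^d, ‖·‖_q)`. -/
def IsQContRigidMotion (q : ℝ) {d : ℕ} (Γ : (Fin d → ℝ) → ℝ → Fin d → ℝ) : Prop :=
  (∀ t ∈ Icc (-1 : ℝ) 1, ∀ x y, qnorm q (Γ x t - Γ y t) = qnorm q (x - y)) ∧
    (∀ x, ContinuousOn (Γ x) (Icc (-1 : ℝ) 1)) ∧ ∀ x, Γ x 0 = x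

/-- An infinitesimal rigid motion of `(ℝ^d, ‖·‖_q)`. -/
def IsQInfRigidMotion (q : ℝ) {d : ℕ} (γ : (Fin d → ℝ) → Fin d → ℝ) : Prop :=
  ∃ Γ, IsQContRigidMotion q Γ ∧ ∀ x, HasDerivWithinAt (Γ x) (γ x) (Icc (-1 : ℝ) 1) 0

/-- `u` is a trivial flex on the vertex set `S`, for the `ℓ^q` norm. -/
def IsQTrivialOn (q : ℝ) {d : ℕ} (p : V → Fin d → ℝ) (S : Set V) (u : V → Fin d → ℝ) : Prop :=
  ∃ γ, IsQInfRigidMotion q γ ∧ ∀ v ∈ S, u v = γ (p v)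

/-- The framework `(G,p)` is infinitesimally rigid in `(ℝ^d, ‖·‖_q)`. -/
def QInfRigid (q : ℝ) {d : ℕ} (G : SimpleGraph V) (p : V → Fin d → ℝ) : Prop :=
  ∀ u, IsQFlex q G p u → IsQTrivialOn q p univ u

/-- The subframework on the subgraph `H` is infinitesimally rigid in `(ℝ^d, ‖·‖_q)`. -/
def QSubInfRigid (q : ℝ) {d : ℕ} (H : G.Subgraph) (p : V → Fin d → ℝ) : Prop :=
  ∀ u, IsQFlex q H.spanningCoe p u → IsQTrivialOn q p H.verts u

/-! ### The rigidity matrix, regular and generic placements -/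

/-- The entry `sgn(a-b)|a-b|^{q-1}` of the rigidity matrix. -/
def rigidityCoef (q : ℝ) (a b : ℝ) : ℝ := Real.sign (a - b) * |a - b| ^ (q - 1)

/-- The row of the rigidity matrix `R_q(G,p)` corresponding to the (oriented) edge `vw`,
regarded as a vector in `ℝ^{V × d}`. -/
def rigidityRow (q : ℝ) {d : ℕ} (p : V → Fin d → ℝ) (v w : V) : V × Fin d → ℝ :=
  fun x =>
    (if x.1 = v then rigidityCoef q (p v x.2) (p w x.2) else 0) -
      (if x.1 = w then rigidityCoef q (p v x.2) (p w x.2) else 0)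

/-- The rank of the rigidity matrix `R_q(G,p)`, i.e. the dimension of its row space. -/
def rigidityRank (q : ℝ) {d : ℕ} (G : SimpleGraph V) (p : V → Fin d → ℝ) : ℕ :=
  Module.finrank ℝ
    (Submodule.span ℝ {r : V × Fin d → ℝ | ∃ v w, G.Adj v w ∧ r = rigidityRow q p v w})

/-- `(G,p)` is a regular framework in `(ℝ^d, ‖·‖_q)`: the rank of the rigidity matrix is
maximal at `p` over all placements of `G`. -/
def IsRegular (q : ℝ) {d : ℕ} (G : SimpleGraph V) (p : V → Fin d → ℝ) : Prop :=
  IsPlacement G p ∧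
    ∀ x : V → Fin d → ℝ, IsPlacement G x → rigidityRank q G x ≤ rigidityRank q G p

/-- `p` restricts on `W` to a generic placement: it is injective on `W` (a placement of the
complete graph on `W`) and every subframework of the complete graph on `W` is regular. -/
def GenericOn (q : ℝ) {d : ℕ} (p : V → Fin d → ℝ) (W : Set V) : Prop :=
  InjOn p W ∧ ∀ W' : Set V, W' ⊆ W → ∀ H : SimpleGraph W', IsRegular q H (fun x : W' => p x.1)

/-- `p` is a generic placement in `(ℝ^d, ‖·‖_q)`: its restriction to every finite set of
vertices is generic. -/
def IsGeneric (q : ℝ) {d : ℕ} (p : V → Fin d → ℝ) : Prop :=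
  ∀ W : Set V, W.Finite → GenericOn q p W

/-- The graph `G` is rigid in `(ℝ^d, ‖·‖_q)`: every generic placement is infinitesimally
rigid. -/
def Rigid (q : ℝ) (d : ℕ) (G : SimpleGraph V) : Prop :=
  ∀ p : V → Fin d → ℝ, IsGeneric q p → QInfRigid q G p

/-- The graph `G` is sequentially rigid in `(ℝ^d, ‖·‖_q)`: every generic placement is
sequentially infinitesimally rigid. -/
def SeqRigid (q : ℝ) (d : ℕ) (G : SimpleGraph V) : Prop :=
  ∀ p : V → Fin d → ℝ, IsGeneric q p →
    ∃ T : Tower G, VertexComplete T ∧ ∀ k, QSubInfRigid q (T.seq k) p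

/-- The graph `G` is minimally rigid in `(ℝ^d, ‖·‖_q)`. -/
def MinRigid (q : ℝ) (d : ℕ) (G : SimpleGraph V) : Prop :=
  Rigid q d G ∧
    ∀ p : V → Fin d → ℝ, IsGeneric q p → ∀ ⦃v w⦄, G.Adj v w →
      ¬ QInfRigid q (G.deleteEdges {s(v, w)}) p

/-! ### Continuous rigidity in `(ℝ^d, ‖·‖_q)` -/

/-- `α` is a continuous flex of `(G,p)` in `(ℝ^d, ‖·‖_q)`. -/
def IsQContFlex (q : ℝ) {d : ℕ} (G : SimpleGraph V) (p : V → Fin d → ℝ)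
    (α : V → ℝ → Fin d → ℝ) : Prop :=
  (∀ v, ContinuousOn (α v) (Icc (-1 : ℝ) 1)) ∧ (∀ v, α v 0 = p v) ∧
    ∀ ⦃v w⦄, G.Adj v w → ∀ t ∈ Icc (-1 : ℝ) 1, qnorm q (α v t - α w t) = qnorm q (p v - p w)

/-- `(G,p)` is continuously rigid in `(ℝ^d, ‖·‖_q)`: every continuous flex is trivial,
that is, derived from a continuous rigid motion. -/
def QContRigid (q : ℝ) {d : ℕ} (G : SimpleGraph V) (p : V → Fin d → ℝ) : Prop :=
  ∀ α, IsQContFlex q G p α →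
    ∃ Γ, IsQContRigidMotion q Γ ∧ ∀ v, ∀ t ∈ Icc (-1 : ℝ) 1, α v t = Γ (p v) t

/-! ### Sparsity counts -/

/-- A subgraph `H` is `(k,l)`-sparse. -/
def SubSparse (k l : ℕ) (H : G.Subgraph) : Prop :=
  ∀ H' : G.Subgraph, H' ≤ H → 2 ≤ H'.verts.ncard →
    (H'.edgeSet.ncard : ℤ) ≤ (k * H'.verts.ncard : ℤ) - l

/-- A subgraph `H` is `(k,l)`-tight. -/
def SubTight (k l : ℕ) (H : G.Subgraph) : Prop :=
  SubSparse k l H ∧ (H.edgeSet.ncard : ℤ) = (k * H.verts.ncard : ℤ) - l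

/-- A simple graph `G` (on its whole vertex type) is `(k,l)`-sparse. -/
def GraphSparse (k l : ℕ) (G : SimpleGraph V) : Prop :=
  ∀ H : G.Subgraph, 2 ≤ H.verts.ncard →
    (H.edgeSet.ncard : ℤ) ≤ (k * H.verts.ncard : ℤ) - l

/-! ### Graph moves -/

/-- Henneberg vertex extension move of degree 2: adjoin a new vertex `v` together with
edges to two distinct existing vertices. -/
def HennVertexMove (H H' : (⊤ : SimpleGraph V).Subgraph) : Prop :=
  ∃ v v₁ v₂, v ∉ H.verts ∧ v₁ ∈ H.verts ∧ v₂ ∈ H.verts ∧ v₁ ≠ v₂ ∧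
    H'.verts = insert v H.verts ∧
    ∀ a b, H'.Adj a b ↔
      (H.Adj a b ∨ (a = v ∧ (b = v₁ ∨ b = v₂)) ∨ (b = v ∧ (a = v₁ ∨ a = v₂)))

/-- Henneberg edge move of degree 2: remove an edge `v₁v₂` and adjoin a new vertex `v`
together with edges to `v₁`, `v₂` and a third existing vertex `v₃`. -/
def HennEdgeMove (H H' : (⊤ : SimpleGraph V).Subgraph) : Prop :=
  ∃ v v₁ v₂ v₃, v ∉ H.verts ∧ v₁ ∈ H.verts ∧ v₂ ∈ H.verts ∧ v₃ ∈ H.verts ∧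
    H.Adj v₁ v₂ ∧ v₃ ≠ v₁ ∧ v₃ ≠ v₂ ∧
    H'.verts = insert v H.verts ∧
    ∀ a b, H'.Adj a b ↔
      ((H.Adj a b ∧ ¬((a = v₁ ∧ b = v₂) ∨ (a = v₂ ∧ b = v₁))) ∨
        (a = v ∧ (b = v₁ ∨ b = v₂ ∨ b = v₃)) ∨ (b = v ∧ (a = v₁ ∨ a = v₂ ∨ a = v₃)))

/-- Vertex-to-`K₄` move: a vertex `w₀` is chosen, three new vertices `w₁,w₂,w₃` are
adjoined together with all edges among `{w₀,w₁,w₂,w₃}`, and every edge `xw₀` is either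
kept or replaced by an edge `x(f x)` with `f x ∈ {w₀,w₁,w₂,w₃}`. -/
def VertexToK4Move (H H' : (⊤ : SimpleGraph V).Subgraph) : Prop :=
  ∃ w₀ w₁ w₂ w₃, w₀ ∈ H.verts ∧ w₁ ∉ H.verts ∧ w₂ ∉ H.verts ∧ w₃ ∉ H.verts ∧
    w₁ ≠ w₂ ∧ w₁ ≠ w₃ ∧ w₂ ≠ w₃ ∧
    ∃ f : V → V, (∀ x, f x = w₀ ∨ f x = w₁ ∨ f x = w₂ ∨ f x = w₃) ∧
      H'.verts = insert w₁ (insert w₂ (insert w₃ H.verts)) ∧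
      ∀ a b, H'.Adj a b ↔
        ((H.Adj a b ∧ a ≠ w₀ ∧ b ≠ w₀) ∨
          (∃ x, H.Adj x w₀ ∧ ((a = x ∧ b = f x) ∨ (b = x ∧ a = f x))) ∨
          (a ∈ ({w₀, w₁, w₂, w₃} : Set V) ∧ b ∈ ({w₀, w₁, w₂, w₃} : Set V) ∧ a ≠ b))

/-- Vertex-to-4-cycle move: a vertex `v` with neighbours `v₁,v₂` is chosen, a new vertex
`v₀` is adjoined together with the edges `v₀v₁`, `v₀v₂`, and every other edge `vw` is
either kept or replaced by the edge `v₀w`. -/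
def VertexTo4CycleMove (H H' : (⊤ : SimpleGraph V).Subgraph) : Prop :=
  ∃ v v₀ v₁ v₂, v ∈ H.verts ∧ v₀ ∉ H.verts ∧ v₁ ≠ v₂ ∧
    H.Adj v v₁ ∧ H.Adj v v₂ ∧
    ∃ f : V → V, (∀ x, f x = v ∨ f x = v₀) ∧
      H'.verts = insert v₀ H.verts ∧
      ∀ a b, H'.Adj a b ↔
        ((H.Adj a b ∧ a ≠ v ∧ b ≠ v) ∨
          ((a = v ∨ a = v₀) ∧ (b = v₁ ∨ b = v₂)) ∨
          ((b = v ∨ b = v₀) ∧ (a = v₁ ∨ a = v₂)) ∨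
          (∃ w, H.Adj v w ∧ w ≠ v₁ ∧ w ≠ v₂ ∧ ((a = f w ∧ b = w) ∨ (b = f w ∧ a = w))))

/-! ### Multigraphs -/

/-- `(V',E')` is a subgraph of the multigraph with edge-endpoint map `ends`. -/
def MGSubgraph (ends : E → Sym2 V) (V' : Set V) (E' : Set E) : Prop :=
  ∀ e ∈ E', ∀ v ∈ ends e, v ∈ V'

/-- The (multigraph) subgraph `(V',E')` is `(k,l)`-sparse. -/
def MGSparseOn (k l : ℕ) (ends : E → Sym2 V) (V' : Set V) (E' : Set E) : Prop :=
  ∀ (V'' : Set V) (E'' : Set E), V'' ⊆ V' → E'' ⊆ E' → MGSubgraph ends V'' E'' →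
    2 ≤ V''.ncard → (E''.ncard : ℤ) ≤ (k * V''.ncard : ℤ) - l

/-- The (multigraph) subgraph `(V',E')` is `(k,l)`-tight. -/
def MGTightOn (k l : ℕ) (ends : E → Sym2 V) (V' : Set V) (E' : Set E) : Prop :=
  MGSparseOn k l ends V' E' ∧ (E'.ncard : ℤ) = (k * V'.ncard : ℤ) - l

/-- The degree of a vertex in a loopless multigraph. -/
def mgDeg (ends : E → Sym2 V) (v : V) : ℕ := {e | v ∈ ends e}.ncard

/-- The signed power. -/
def sgnPow (q s : ℝ) : ℝ := Real.sign s * |s| ^ (q - 1)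

/-- The `q`-th power of the `q`-norm. -/
def powSum (q : ℝ) {d : ℕ} (z : Fin d → ℝ) : ℝ := ∑ i, |z i| ^ q

lemma sgnPow_eq {q s : ℝ} : |s| ^ (q - 2) * s = sgnPow q s := by
  unfold sgnPow
  rcases eq_or_ne s 0 with rfl | hs
  · simp
  · have h0 : 0 < |s| := abs_pos.2 hs
    have : |s| ^ (q - 1) = |s| ^ (q - 2) * |s| := by
      rw [← Real.rpow_add_one h0.ne']; congr 1; ring
    rw [this]
    have h2 : Real.sign s * |s| = s := by
      rcases lt_or_gt_of_ne hs with h | h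
      · rw [Real.sign_of_neg h, abs_of_neg h]; ring
      · rw [Real.sign_of_pos h, abs_of_pos h]; ring
    calc |s| ^ (q - 2) * s = |s| ^ (q - 2) * (Real.sign s * |s|) := by rw [h2]
      _ = _ := by ring

lemma hasDerivAt_absPow {q : ℝ} (hq : 1 < q) (s : ℝ) :
    HasDerivAt (fun x : ℝ => |x| ^ q) (q * sgnPow q s) s := by
  have := hasDerivAt_abs_rpow s hq
  rwa [mul_assoc, sgnPow_eq] at this

lemma contDiff_absPow {q : ℝ} (hq : 1 < q) : ContDiff ℝ 1 (fun x : ℝ => |x| ^ q) := by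
  simpa using contDiff_norm_rpow (E := ℝ) hq

lemma continuous_sgnPow {q : ℝ} (hq : 1 < q) : Continuous (sgnPow q) := by
  have h := (contDiff_absPow hq).continuous_deriv le_rfl
  have h2 : sgnPow q = fun s => q⁻¹ * deriv (fun x : ℝ => |x| ^ q) s := by
    funext s
    rw [(hasDerivAt_absPow hq s).deriv]
    field_simp
  rw [h2]
  fun_prop

lemma sgnPow_zero {q : ℝ} : sgnPow q 0 = 0 := by simp [sgnPow]
lemma sgnPow_one {q : ℝ} : sgnPow q 1 = 1 := by simp [sgnPow]
lemma sgnPow_neg {q s : ℝ} : sgnPow q (-s) = - sgnPow q s := by simp [sgnPow, Real.sign_neg]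
lemma sgnPow_two {q : ℝ} : sgnPow q 2 = 2 ^ (q - 1) := by simp [sgnPow, Real.sign_of_pos]

lemma sgnPow_two_ne {q : ℝ} (hq2 : q ≠ 2) : sgnPow q 2 ≠ 2 := by
  rw [sgnPow_two]
  intro h
  have h3 : (2 : ℝ) ^ (q - 1) = 2 ^ (1 : ℝ) := by rw [h]; simp
  have h4 := congrArg Real.log h3
  rw [Real.log_rpow (by norm_num), Real.log_rpow (by norm_num)] at h4
  have h5 := mul_right_cancel₀ (Real.log_pos (by norm_num : (1:ℝ) < 2)).ne' h4
  apply hq2; linarith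

lemma powSum_nonneg (q : ℝ) {d : ℕ} (z : Fin d → ℝ) : 0 ≤ powSum q z :=
  Finset.sum_nonneg fun i _ => Real.rpow_nonneg (abs_nonneg _) _

lemma qnorm_eq_iff {q : ℝ} (hq : 1 < q) {d : ℕ} (x y : Fin d → ℝ) :
    qnorm q x = qnorm q y ↔ powSum q x = powSum q y := by
  unfold qnorm
  constructor
  · intro h
    exact Real.rpow_left_injOn (x := 1 / q) (by positivity) (powSum_nonneg q x)
      (powSum_nonneg q y) h
  · intro h
    unfold powSum at h
    rw [h]

lemma powSum_pos {q : ℝ} {d : ℕ} {z : Fin d → ℝ} (hz : z ≠ 0) : 0 < powSum q z := by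
  obtain ⟨i, hi⟩ := Function.ne_iff.1 hz
  exact Finset.sum_pos' (fun i _ => Real.rpow_nonneg (abs_nonneg _) _)
    ⟨i, Finset.mem_univ _, Real.rpow_pos_of_pos (abs_pos.2 hi) _⟩

/-- pairing -/
def pair (q : ℝ) {d : ℕ} (z h : Fin d → ℝ) : ℝ := ∑ i, sgnPow q (z i) * h i

/-- the differential of the edge length -/
def edgeL (q : ℝ) {V : Type} [Fintype V] {d : ℕ} (x : V → Fin d → ℝ) (v w : V) :
    (V → Fin d → ℝ) →L[ℝ] ℝ :=
  ∑ i, (q * sgnPow q ((x v - x w) i)) •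
    ((ContinuousLinearMap.proj (R := ℝ) (φ := fun _ : Fin d => ℝ) i).comp
      (ContinuousLinearMap.proj (R := ℝ) (φ := fun _ : V => Fin d → ℝ) v -
        ContinuousLinearMap.proj (R := ℝ) (φ := fun _ : V => Fin d → ℝ) w))

lemma edgeL_apply (q : ℝ) {V : Type} [Fintype V] {d : ℕ} (x : V → Fin d → ℝ) (v w : V)
    (h : V → Fin d → ℝ) : edgeL q x v w h = q * pair q (x v - x w) (h v - h w) := by
  simp [edgeL, pair, Finset.mul_sum, mul_assoc]

lemma hasFDerivAt_edge {q : ℝ} (hq : 1 < q) {V : Type} [Fintype V] {d : ℕ}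
    (x : V → Fin d → ℝ) (v w : V) :
    HasFDerivAt (fun y : V → Fin d → ℝ => powSum q (y v - y w)) (edgeL q x v w) x := by
  unfold powSum edgeL
  refine HasFDerivAt.fun_sum fun i _ => ?_
  exact (hasDerivAt_absPow hq ((x v - x w) i)).comp_hasFDerivAt x
    (f := fun y : V → Fin d → ℝ => (y v - y w) i)
    (ContinuousLinearMap.hasFDerivAt
      ((ContinuousLinearMap.proj (R := ℝ) (φ := fun _ : Fin d => ℝ) i).comp
      (ContinuousLinearMap.proj (R := ℝ) (φ := fun _ : V => Fin d → ℝ) v -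
        ContinuousLinearMap.proj (R := ℝ) (φ := fun _ : V => Fin d → ℝ) w)))

lemma contDiff_edge {q : ℝ} (hq : 1 < q) {V : Type} [Fintype V] {d : ℕ} (v w : V) :
    ContDiff ℝ 1 (fun y : V → Fin d → ℝ => powSum q (y v - y w)) := by
  unfold powSum
  refine ContDiff.sum fun i _ => ?_
  exact (contDiff_absPow hq).comp (f := fun y : V → Fin d → ℝ => (y v - y w) i)
    (by simp only [Pi.sub_apply]; fun_prop)

lemma isQFlex_iff {q : ℝ} (hq : 1 < q) {V : Type} [Fintype V] {d : ℕ} (G : SimpleGraph V)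
    (p u : V → Fin d → ℝ) (hp : IsPlacement G p) :
    IsQFlex q G p u ↔ ∀ ⦃v w⦄, G.Adj v w → pair q (p v - p w) (u v - u w) = 0 := by
  refine forall_congr' fun v => forall_congr' fun w => forall_congr' fun hvw => ?_
  have hz : p v - p w ≠ 0 := sub_ne_zero.2 (hp hvw)
  have hpos := powSum_pos (q := q) hz
  have h1 : HasDerivAt (fun t : ℝ => p + t • u) u 0 := by
    simpa using ((hasDerivAt_id (0:ℝ)).smul_const u).const_add p
  have h2 := (hasFDerivAt_edge hq (p + (0:ℝ) • u) v w).comp_hasDerivAt (0:ℝ) h1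
  have h3 : HasDerivAt (fun t : ℝ => qnorm q ((p v + t • u v) - (p w + t • u w))) _ 0 :=
    h2.rpow_const (p := 1 / q) (Or.inl (by simpa using hpos.ne'))
  rw [edgeL_apply] at h3
  simp only [zero_smul, add_zero] at h3
  constructor
  · intro h
    have h4 : HasDerivAt (fun t : ℝ => qnorm q ((p v + t • u v) - (p w + t • u w))) 0 0 := by
      rw [hasDerivAt_iff_isLittleO]
      simpa using h
    have h5 := h3.unique h4
    have h6 : powSum q (p v - p w) ^ (q⁻¹ - 1) ≠ 0 := (Real.rpow_pos_of_pos hpos _).ne'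
    have hq0 : q ≠ 0 := by linarith
    simpa [hq0, h6] using h5
  · intro h
    rw [h] at h3
    rw [hasDerivAt_iff_isLittleO] at h3
    simpa using h3

/-- Lemma A: if the only linear flexes are constant, continuous flexes are translations. -/
lemma contFlex_translation {q : ℝ} (hq : 1 < q) {V : Type} [Fintype V] {d : ℕ}
    (R : V → V → Prop) (p : V → Fin d → ℝ)
    (hker : ∀ u : V → Fin d → ℝ, (∀ v w, R v w → pair q (p v - p w) (u v - u w) = 0) →
      ∀ v w, u v = u w)
    (α : V → ℝ → Fin d → ℝ) (hc : ∀ v, ContinuousOn (α v) (Icc (-1 : ℝ) 1))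
    (h0 : ∀ v, α v 0 = p v)
    (hα : ∀ v w, R v w → ∀ t ∈ Icc (-1 : ℝ) 1, qnorm q (α v t - α w t) = qnorm q (p v - p w))
    (v v₀ : V) (t : ℝ) (ht : t ∈ Icc (-1 : ℝ) 1) : α v t - α v₀ t = p v - p v₀ := by
  -- the normalised path
  let β : ℝ → V → Fin d → ℝ := fun t v => α v t - α v₀ t + p v₀
  have hβc : ContinuousOn β (Icc (-1 : ℝ) 1) := by
    rw [continuousOn_pi]
    intro v
    exact ((hc v).sub (hc v₀)).add continuousOn_const
  let F : (V → Fin d → ℝ) → (V × V → ℝ) × (Fin d → ℝ) := fun x =>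
    (fun e => if R e.1 e.2 then powSum q (x e.1 - x e.2) else 0, x v₀)
  let F' : (V → Fin d → ℝ) →L[ℝ] (V × V → ℝ) × (Fin d → ℝ) :=
    (ContinuousLinearMap.pi fun e : V × V => if R e.1 e.2 then edgeL q p e.1 e.2 else 0).prod
      (ContinuousLinearMap.proj (R := ℝ) (φ := fun _ : V => Fin d → ℝ) v₀)
  have hF : HasFDerivAt F F' p := by
    refine HasFDerivAt.prodMk (hasFDerivAt_pi.2 fun e => ?_) (ContinuousLinearMap.hasFDerivAt
      (ContinuousLinearMap.proj (R := ℝ) (φ := fun _ : V => Fin d → ℝ) v₀))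
    split_ifs
    · exact hasFDerivAt_edge hq p e.1 e.2
    · exact hasFDerivAt_const _ _
  have hinj : Function.Injective F' := by
    rw [injective_iff_map_eq_zero]
    intro u hu
    have h1 : ∀ v w, R v w → pair q (p v - p w) (u v - u w) = 0 := by
      intro v w hvw
      have := congrFun (congrArg Prod.fst hu) (v, w)
      simp only [F', ContinuousLinearMap.prod_apply, ContinuousLinearMap.coe_pi', hvw, if_true,
        edgeL_apply] at this
      have hq0 : q ≠ 0 := by linarith
      simpa [hq0] using this
    have h2 : u v₀ = 0 := congrArg Prod.snd hu
    funext v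
    rw [hker u h1 v v₀, h2]; rfl
  obtain ⟨K, -, hK⟩ := (LinearMap.injective_iff_antilipschitz F'.toLinearMap).1 hinj
  have hev : ∀ᶠ z in 𝓝 p, F z = F p → z = p := by
    have := hF.eventually_ne (c := F p) ⟨K, hK⟩
    rw [eventually_nhdsWithin_iff] at this
    filter_upwards [this] with z hz h
    by_contra hne
    exact hz hne h
  have hFβ : ∀ t ∈ Icc (-1 : ℝ) 1, F (β t) = F p := by
    intro t ht
    refine Prod.ext (funext fun e => ?_) ?_
    · simp only [F, β]
      split_ifs with h
      · have := (qnorm_eq_iff hq _ _).1 (hα _ _ h t ht)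
        rw [← this]; congr 1; abel
      · rfl
    · simp [F, β]
  have hmain : Icc (-1 : ℝ) 1 ⊆ {t | β t = p} := by
    have : PreconnectedSpace (Icc (-1 : ℝ) 1) :=
      Subtype.preconnectedSpace isPreconnected_Icc
    have hcr : Continuous (fun t : Icc (-1 : ℝ) 1 => β t) := continuousOn_iff_continuous_domRestrict.1 hβc
    have hclopen : IsClopen {t : Icc (-1 : ℝ) 1 | β t = p} := by
      refine ⟨isClosed_eq hcr continuous_const, isOpen_iff_mem_nhds.2 fun t ht => ?_⟩
      have h1 : Tendsto (fun t : Icc (-1 : ℝ) 1 => β t) (𝓝 t) (𝓝 p) := by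
        have := hcr.tendsto t
        rwa [show β t = p from ht] at this
      filter_upwards [h1.eventually hev] with s hs
      exact hs (hFβ s s.2)
    have huniv := hclopen.eq_univ ⟨⟨0, by norm_num⟩, by
      show β 0 = p
      funext v; simp [β, h0]⟩
    intro t ht
    have : (⟨t, ht⟩ : Icc (-1 : ℝ) 1) ∈ {t : Icc (-1 : ℝ) 1 | β t = p} := by
      rw [huniv]; trivial
    exact this
  have := congrFun (hmain ht) v
  simp only [β] at this
  rw [← this]; abel

lemma pair_single {q : ℝ} {d : ℕ} (i : Fin d) (s : ℝ) (h : Fin d → ℝ) :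
    pair q (Pi.single i s) h = sgnPow q s * h i := by
  unfold pair
  rw [Finset.sum_eq_single i]
  · simp
  · intro j _ hj; simp [hj, sgnPow_zero]
  · simp

lemma pair_split {q : ℝ} {d : ℕ} (i : Fin d) (z h : Fin d → ℝ) :
    pair q z h = sgnPow q (z i) * h i + ∑ j ∈ Finset.univ.erase i, sgnPow q (z j) * h j := by
  unfold pair
  exact (Finset.add_sum_erase _ (fun j => sgnPow q (z j) * h j) (Finset.mem_univ i)).symm

/-- Lemma B: the functional equation on a grid has only constant solutions. -/
lemma grid_const {q : ℝ} (hq2 : q ≠ 2) {d : ℕ} (S : Set (Fin d → ℝ))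
    (hz : (0 : Fin d → ℝ) ∈ S) (he : ∀ i, Pi.single i 1 ∈ S) (he' : ∀ i, Pi.single i (-1) ∈ S)
    (hu : ∀ x ∈ S, ∀ i, Function.update x i 1 ∈ S) (g : (Fin d → ℝ) → Fin d → ℝ)
    (hg : ∀ x ∈ S, ∀ y ∈ S, pair q (x - y) (g x - g y) = 0) :
    ∀ x ∈ S, g x = g 0 := by
  -- normalise
  suffices H : ∀ g : (Fin d → ℝ) → Fin d → ℝ, g 0 = 0 →
      (∀ x ∈ S, ∀ y ∈ S, pair q (x - y) (g x - g y) = 0) → ∀ x ∈ S, g x = 0 by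
    intro x hx
    have := H (fun y => g y - g 0) (by simp) (by
      intro x hx y hy
      have := hg x hx y hy
      simpa using this) x hx
    exact sub_eq_zero.1 this
  clear hg g
  intro g g0 hg
  have two_ne := sgnPow_two_ne hq2
  -- `g_i` vanishes on the axis `i`
  have hd1 : ∀ i, g (Pi.single i 1) i = 0 := by
    intro i
    have := hg _ (he i) _ hz
    rw [sub_zero, pair_single, sgnPow_one, g0] at this
    simpa using this
  have hd2 : ∀ i, g (Pi.single i (-1)) i = 0 := by
    intro i
    have := hg _ (he' i) _ hz
    rw [sub_zero, pair_single, sgnPow_neg, sgnPow_one, g0] at this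
    simpa using this
  have hcross : ∀ i j, i ≠ j → ∀ s : ℝ, g (Pi.single i s) i = 0 → Pi.single i s ∈ S →
      g (Pi.single i s) j = sgnPow q (-s) * g (Pi.single j 1) i := by
    intro i j hij s h1 h2
    have := hg _ (he j) _ h2
    rw [pair_split i, Finset.sum_eq_single j] at this
    · simp [hij, hij.symm, sgnPow_one, hd1, h1] at this
      linarith
    · intro k hk hkj
      have hki := Finset.ne_of_mem_erase hk
      simp [hkj, hki, sgnPow_zero]
    · simp [hij.symm]
  have hodd : ∀ i j, i ≠ j → g (Pi.single i (-1)) j = - g (Pi.single i 1) j := by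
    intro i j hij
    rw [hcross i j hij _ (hd1 i) (he i), hcross i j hij _ (hd2 i) (he' i), neg_neg, sgnPow_neg,
      sgnPow_one]
    ring
  have key : ∀ x ∈ S, ∀ i, x i = 1 → g x i = 0 := by
    intro x hx i hxi
    have e0 := hg x hx 0 hz
    have e1 := hg x hx _ (he i)
    have e2 := hg x hx _ (he' i)
    rw [pair_split i] at e0 e1 e2
    have f1 : ∑ j ∈ Finset.univ.erase i, sgnPow q ((x - (Pi.single i 1 : Fin d → ℝ)) j) *
        (g x - g (Pi.single i 1)) j = ∑ j ∈ Finset.univ.erase i, sgnPow q (x j) * g x j -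
        ∑ j ∈ Finset.univ.erase i, sgnPow q (x j) * g (Pi.single i 1) j := by
      rw [← Finset.sum_sub_distrib]
      refine Finset.sum_congr rfl fun j hj => ?_
      have hji := Finset.ne_of_mem_erase hj
      simp [hji]; ring
    have f2 : ∑ j ∈ Finset.univ.erase i, sgnPow q ((x - (Pi.single i (-1) : Fin d → ℝ)) j) *
        (g x - g (Pi.single i (-1))) j = ∑ j ∈ Finset.univ.erase i, sgnPow q (x j) * g x j +
        ∑ j ∈ Finset.univ.erase i, sgnPow q (x j) * g (Pi.single i 1) j := by
      rw [← Finset.sum_add_distrib]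
      refine Finset.sum_congr rfl fun j hj => ?_
      have hji := Finset.ne_of_mem_erase hj
      simp [hji, hodd i j hji.symm]; ring
    rw [f1] at e1
    rw [f2] at e2
    simp [hxi, g0, sgnPow_one] at e0
    simp [hxi, sgnPow_zero, sgnPow_one, hd1] at e1
    simp [hxi, hd1, hd2, sgnPow_one, show (1:ℝ) + 1 = 2 by norm_num] at e2
    have : (sgnPow q 2 - 2) * g x i = 0 := by linarith
    rcases mul_eq_zero.1 this with h | h
    · exact absurd (sub_eq_zero.1 h) two_ne
    · exact h
  intro x hx
  funext i
  by_cases hxi : x i = 1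
  · exact key x hx i hxi
  have h1 := hg x hx _ (hu x hx i)
  have h2 := key _ (hu x hx i) i (by simp)
  have h3 : x - Function.update x i 1 = Pi.single i (x i - 1) := by
    funext j
    rcases eq_or_ne j i with rfl | hj
    · simp
    · simp [hj]
  rw [h3, pair_single] at h1
  have h4 : sgnPow q (x i - 1) ≠ 0 := by
    have : x i - 1 ≠ 0 := sub_ne_zero.2 hxi
    unfold sgnPow
    refine mul_ne_zero ?_ (Real.rpow_pos_of_pos (abs_pos.2 this) _).ne'
    rwa [Ne, Real.sign_eq_zero_iff]
  have := (mul_eq_zero.1 h1).resolve_left h4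
  simpa [h2] using this

/-- Continuous rigid motions are translations. -/
lemma rigidMotion_translation {q : ℝ} (hq : 1 < q) (hq2 : q ≠ 2) {d : ℕ}
    {Γ : (Fin d → ℝ) → ℝ → Fin d → ℝ} (hΓ : IsQContRigidMotion q Γ) (x : Fin d → ℝ)
    (t : ℝ) (ht : t ∈ Icc (-1 : ℝ) 1) : Γ x t - Γ 0 t = x := by
  let S : Finset (Fin d → ℝ) := Fintype.piFinset fun i => ({0, 1, -1, x i} : Finset ℝ)
  have hz : (0 : Fin d → ℝ) ∈ S := by simp [S]
  have hx : x ∈ S := by simp [S]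
  have hs : ∀ i, ∀ s : ℝ, s = 1 ∨ s = -1 → Pi.single i s ∈ S := by
    intro i s hs
    simp only [S, Fintype.mem_piFinset]
    intro j
    rcases eq_or_ne j i with rfl | hj
    · rcases hs with rfl | rfl <;> simp
    · simp [hj]
  have hu : ∀ y ∈ S, ∀ i, Function.update y i 1 ∈ S := by
    intro y hy i
    simp only [S, Fintype.mem_piFinset] at hy ⊢
    intro j
    rcases eq_or_ne j i with rfl | hj
    · simp
    · simpa [hj] using hy j
  have := contFlex_translation hq (V := S) (fun _ _ => True) (fun v => v.1) (by
    intro u hu'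
    let g : (Fin d → ℝ) → Fin d → ℝ := fun y => if h : y ∈ S then u ⟨y, h⟩ else 0
    have hg := grid_const hq2 (S : Set (Fin d → ℝ)) hz (fun i => hs i _ (Or.inl rfl))
      (fun i => hs i _ (Or.inr rfl)) hu g (by
        intro y hy z hz
        rw [Finset.mem_coe] at hy hz
        simp only [g, hy, hz, dif_pos]
        exact hu' ⟨y, hy⟩ ⟨z, hz⟩ trivial)
    have hg' : ∀ v : S, u v = g 0 := by
      intro v
      rw [← hg v.1 v.2]
      simp [g]
    intro v w
    rw [hg' v, hg' w]) (fun v => Γ v.1) (fun v => hΓ.2.1 _) (fun v => hΓ.2.2 _)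
    (fun v w _ t ht => hΓ.1 t ht _ _) ⟨x, hx⟩ ⟨0, hz⟩ t ht
  simpa using this

lemma isQTrivialOn_iff {q : ℝ} (hq : 1 < q) (hq2 : q ≠ 2) {V : Type} {d : ℕ}
    (p u : V → Fin d → ℝ) : IsQTrivialOn q p univ u ↔ ∀ v w, u v = u w := by
  constructor
  · rintro ⟨γ, ⟨Γ, hΓ, hγ⟩, hu⟩
    have h0 : (0:ℝ) ∈ Icc (-1 : ℝ) 1 := by norm_num
    have key : ∀ x, γ x = γ 0 := by
      intro x
      have h1 : HasDerivWithinAt (fun t => x + Γ 0 t) (γ 0) (Icc (-1 : ℝ) 1) 0 :=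
        (hγ 0).const_add x
      have h2 : HasDerivWithinAt (Γ x) (γ 0) (Icc (-1 : ℝ) 1) 0 := by
        refine h1.congr_of_mem (fun t ht => ?_) h0
        exact eq_add_of_sub_eq (rigidMotion_translation hq hq2 hΓ x t ht)
      exact (uniqueDiffOn_Icc (by norm_num : (-1:ℝ) < 1) 0 h0).eq_deriv _ (hγ x) h2
    intro v w
    rw [hu v trivial, hu w trivial, key (p v), key (p w)]
  · intro h
    have : ∃ c, ∀ v, u v = c := by
      rcases isEmpty_or_nonempty V with hV | ⟨⟨v₀⟩⟩
      · exact ⟨0, fun v => hV.elim v⟩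
      · exact ⟨u v₀, fun v => h v v₀⟩
    obtain ⟨c, hc⟩ := this
    refine ⟨fun _ => c, ⟨fun x t => x + t • c, ⟨fun t _ x y => ?_, fun x => ?_, fun x => ?_⟩,
      fun x => ?_⟩, fun v _ => hc v⟩
    · congr 1; exact add_sub_add_right_eq_sub _ _ _
    · fun_prop
    · simp
    · have := ((hasDerivAt_id (0:ℝ)).smul_const c).const_add x
      simpa using this.hasDerivWithinAt

lemma qInfRigid_iff {q : ℝ} (hq : 1 < q) (hq2 : q ≠ 2) {V : Type} [Fintype V] {d : ℕ}
    (G : SimpleGraph V) (p : V → Fin d → ℝ) (hp : IsPlacement G p) :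
    QInfRigid q G p ↔ ∀ u : V → Fin d → ℝ,
      (∀ v w, G.Adj v w → pair q (p v - p w) (u v - u w) = 0) → ∀ v w, u v = u w := by
  refine forall_congr' fun u => ?_
  rw [isQFlex_iff hq G p u hp, isQTrivialOn_iff hq hq2]

lemma row_dot (q : ℝ) {V : Type} [Fintype V] {d : ℕ} (p u : V → Fin d → ℝ) (v w : V) :
    ∑ x : V × Fin d, rigidityRow q p v w x * u x.1 x.2 = pair q (p v - p w) (u v - u w) := by
  have h : ∀ i : Fin d, ∑ y : V, rigidityRow q p v w (y, i) * u y i =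
      sgnPow q ((p v - p w) i) * (u v - u w) i := by
    intro i
    simp only [rigidityRow, sub_mul, ite_mul, zero_mul, Finset.sum_sub_distrib,
      Finset.sum_ite_eq', Finset.mem_univ, if_true, Pi.sub_apply]
    simp only [rigidityCoef, sgnPow]
    ring
  rw [Fintype.sum_prod_type, Finset.sum_comm]
  simp only [h]
  rfl

lemma functional_eq {ι : Type} [Fintype ι] (f : (ι → ℝ) →ₗ[ℝ] ℝ) (r : ι → ℝ) :
    f r = ∑ x, r x * f (Pi.single x 1) := by
  conv_lhs => rw [pi_eq_sum_univ' r]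
  simp

lemma regular_of_ker {q : ℝ} {V : Type} [Fintype V] {d : ℕ}
    (G : SimpleGraph V) (p : V → Fin d → ℝ) (hp : IsPlacement G p)
    (hker : ∀ u : V → Fin d → ℝ,
      (∀ v w, G.Adj v w → pair q (p v - p w) (u v - u w) = 0) → ∀ v w, u v = u w) :
    IsRegular q G p := by
  refine ⟨hp, fun x _ => Submodule.finrank_mono ?_⟩
  rw [Submodule.span_le]
  rintro r ⟨v, w, hvw, rfl⟩
  by_contra hr
  obtain ⟨f, hf0, hf⟩ := Submodule.exists_le_ker_of_notMem hr
  obtain ⟨u, hu⟩ : ∃ u : V → Fin d → ℝ, ∀ r, f r = ∑ x, r x * u x.1 x.2 :=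
    by
    obtain ⟨y, hy⟩ : ∃ y : V × Fin d → ℝ, ∀ r, f r = ∑ x, r x * y x := ⟨_, functional_eq f⟩
    exact ⟨fun v i => y (v, i), hy⟩
  have hconst := hker u (by
    intro v w hvw
    rw [← row_dot, ← hu]
    exact hf (Submodule.subset_span ⟨v, w, hvw, rfl⟩))
  apply hf0
  rw [hu, row_dot, hconst v w]
  simp [pair]

lemma exists_curve {X Y : Type} [NormedAddCommGroup X] [NormedSpace ℝ X] [CompleteSpace X]
    [NormedAddCommGroup Y] [NormedSpace ℝ Y] [FiniteDimensional ℝ Y] (f : X → Y)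
    (hf : ContDiff ℝ 1 f) (p : X) (L : X →L[ℝ] Y) (hL : HasFDerivAt f L p)
    (hsurj : Function.Surjective L) (u : X) (hu : L u = 0) :
    ∃ c : ℝ → X, c 0 = p ∧ HasDerivAt c u 0 ∧ ContDiffAt ℝ 1 c 0 ∧
      ∀ᶠ t in 𝓝 (0:ℝ), f (c t) = f p := by
  have : CompleteSpace Y := FiniteDimensional.complete ℝ Y
  obtain ⟨R₀, hR₀⟩ := L.toLinearMap.exists_rightInverse_of_surjective
    (LinearMap.range_eq_top.2 hsurj)
  let R : Y →L[ℝ] X := LinearMap.toContinuousLinearMap R₀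
  have hLR : ∀ y, L (R y) = y := fun y => LinearMap.congr_fun hR₀ y
  let A : ℝ × Y →L[ℝ] X :=
    (ContinuousLinearMap.toSpanSingleton ℝ u).comp (ContinuousLinearMap.fst ℝ ℝ Y) +
      R.comp (ContinuousLinearMap.snd ℝ ℝ Y)
  have hA : ∀ z, A z = z.1 • u + R z.2 := fun z => by simp [A]
  let g : ℝ × Y → Y := fun z => f (p + A z)
  have hg : ContDiffAt ℝ 1 g (0, 0) := by
    apply ContDiff.contDiffAt
    exact hf.comp (contDiff_const.add A.contDiff)
  have hg' : HasFDerivAt g (L.comp A) (0, 0) := by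
    have h1 : HasFDerivAt (fun z => p + A z) A (0, 0) := A.hasFDerivAt.const_add p
    refine HasFDerivAt.comp _ ?_ h1
    have : p + A ((0, 0) : ℝ × Y) = p := by simp [hA]
    rw [this]; exact hL
  have hinr : fderiv ℝ g (0, 0) ∘L .inr ℝ ℝ Y = .id ℝ Y := by
    rw [hg'.fderiv]
    ext y
    simp [hA, hLR]
  have hinl : fderiv ℝ g (0, 0) ∘L .inl ℝ ℝ Y = 0 := by
    rw [hg'.fderiv]
    ext
    simp [hA, hu]
  have hinv : (fderiv ℝ g (0, 0) ∘L .inr ℝ ℝ Y).IsInvertible := by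
    rw [hinr]
    exact ⟨ContinuousLinearEquiv.refl ℝ Y, rfl⟩
  let ψ := hg.implicitFunction one_ne_zero hinv
  have hψ0 : ψ 0 = 0 := hg.implicitFunction_apply_self one_ne_zero hinv
  have hψe := hg.eventually_apply_implicitFunction one_ne_zero hinv
  have hψd := (hg.hasStrictFDerivAt_implicitFunction one_ne_zero hinv).hasFDerivAt
  have hψc : ContDiffAt ℝ 1 ψ 0 := hg.contDiffAt_implicitFunction one_ne_zero hinv
  rw [hinl, ContinuousLinearMap.comp_zero] at hψd
  have hψd' : HasDerivAt ψ 0 0 := by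
    have := hψd.hasDerivAt
    simpa using this
  refine ⟨fun t => p + (t • u + R (ψ t)), by simp [hψ0], ?_, ?_, ?_⟩
  · have h1 := R.hasFDerivAt.comp_hasDerivAt (0:ℝ) hψd'
    have h2 := (((hasDerivAt_id (0:ℝ)).smul_const u).add h1).const_add p
    simpa using! h2
  · exact contDiffAt_const.add ((contDiffAt_id.smul contDiffAt_const).add
      (R.contDiff.contDiffAt.comp _ hψc))
  · filter_upwards [hψe] with t ht
    have h2 : g (t, ψ t) = g (0, 0) := ht
    simpa [g, hA] using h2

lemma continuous_row {q : ℝ} (hq : 1 < q) {V : Type} [Fintype V] {d : ℕ} (v w : V) :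
    Continuous (fun x : V → Fin d → ℝ => rigidityRow q x v w) := by
  refine continuous_pi fun y => ?_
  unfold rigidityRow
  have h : Continuous (fun x : V → Fin d → ℝ => rigidityCoef q (x v y.2) (x w y.2)) := by
    exact (continuous_sgnPow hq).comp (by fun_prop : Continuous
      fun x : V → Fin d → ℝ => x v y.2 - x w y.2)
  split_ifs <;> fun_prop

lemma exists_flex_curve {q : ℝ} (hq : 1 < q) {V : Type} [Fintype V] {d : ℕ}
    (G : SimpleGraph V) (p : V → Fin d → ℝ) (hreg : IsRegular q G p)
    (u : V → Fin d → ℝ) (hu : ∀ v w, G.Adj v w → pair q (p v - p w) (u v - u w) = 0) :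
    ∃ (c : ℝ → V → Fin d → ℝ) (ε : ℝ), 0 < ε ∧ c 0 = p ∧ HasDerivAt c u 0 ∧
      ContinuousOn c (Icc (-ε) ε) ∧ ∀ v w, G.Adj v w → ∀ t ∈ Icc (-ε) ε,
        powSum q (c t v - c t w) = powSum q (p v - p w) := by
  let row : (V → Fin d → ℝ) → {e : V × V // G.Adj e.1 e.2} → V × Fin d → ℝ :=
    fun x e => rigidityRow q x e.1.1 e.1.2
  have hrange : ∀ x, {r : V × Fin d → ℝ | ∃ v w, G.Adj v w ∧ r = rigidityRow q x v w} =
      Set.range (row x) := by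
    intro x
    ext r
    constructor
    · rintro ⟨v, w, h, rfl⟩; exact ⟨⟨(v, w), h⟩, rfl⟩
    · rintro ⟨e, rfl⟩; exact ⟨_, _, e.2, rfl⟩
  obtain ⟨κ, a, ha, hspan, hli⟩ := exists_linearIndependent' ℝ (row p)
  have : Finite κ := Finite.of_injective a ha
  have : Fintype κ := Fintype.ofFinite κ
  have hq0 : q ≠ 0 := by linarith
  -- nearby rows are spanned by the chosen ones
  have hnear : ∀ᶠ x in 𝓝 p, ∀ e, row x e ∈ Submodule.span ℝ (Set.range (row x ∘ a)) := by
    have h1 : ∀ᶠ x in 𝓝 p, LinearIndependent ℝ (row x ∘ a) := by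
      have hcont : Continuous (fun x => (row x ∘ a : κ → V × Fin d → ℝ)) :=
        continuous_pi fun k => continuous_row hq _ _
      exact hcont.continuousAt.eventually (isOpen_setOfPred_linearIndependent.mem_nhds hli)
    have h2 : ∀ᶠ x in 𝓝 p, IsPlacement G x := by
      have : ∀ v w, ∀ᶠ x : V → Fin d → ℝ in 𝓝 p, G.Adj v w → x v ≠ x w := by
        intro v w
        by_cases h : G.Adj v w
        · have h3 : IsOpen {x : V → Fin d → ℝ | x v ≠ x w} :=
            isOpen_ne_fun (by fun_prop) (by fun_prop)
          filter_upwards [h3.mem_nhds (hreg.1 h)] with x hx _ using hx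
        · exact Eventually.of_forall fun x h' => absurd h' h
      filter_upwards [eventually_all.2 fun v => eventually_all.2 (this v)] with x hx v w using hx v w
    filter_upwards [h1, h2] with x hx1 hx2 e
    have hle : Submodule.span ℝ (Set.range (row x ∘ a)) ≤ Submodule.span ℝ (Set.range (row x)) :=
      Submodule.span_mono (Set.range_comp_subset_range _ _)
    have hrk := hreg.2 x hx2
    unfold rigidityRank at hrk
    rw [hrange, hrange, ← hspan, finrank_span_eq_card hli, ← finrank_span_eq_card hx1] at hrk
    rw [Submodule.eq_of_le_of_finrank_le hle hrk]
    exact Submodule.subset_span ⟨e, rfl⟩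
  -- the chosen edge map
  let f : (V → Fin d → ℝ) → κ → ℝ := fun x k => powSum q (x (a k).1.1 - x (a k).1.2)
  have hf : ContDiff ℝ 1 f := contDiff_pi.2 fun k => contDiff_edge hq _ _
  let L : (V → Fin d → ℝ) →L[ℝ] κ → ℝ :=
    ContinuousLinearMap.pi fun k => edgeL q p (a k).1.1 (a k).1.2
  have hL : HasFDerivAt f L p := hasFDerivAt_pi.2 fun k => hasFDerivAt_edge hq p _ _
  have hLu : L u = 0 := by
    funext k
    simp [L, edgeL_apply, hu _ _ (a k).2]
  have hsurj : Function.Surjective L := by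
    have : LinearMap.range L.toLinearMap = ⊤ := by
      by_contra hne
      obtain ⟨φ, hφ0, hφ⟩ := Submodule.exists_le_ker_of_lt_top _ (lt_top_iff_ne_top.2 hne)
      apply hφ0
      have hz : ∑ k, φ (Pi.single k 1) • (row p ∘ a) k = 0 := by
        funext x
        have h1 : φ (L (Pi.single x.1 (Pi.single x.2 1))) = 0 := hφ ⟨_, rfl⟩
        rw [functional_eq] at h1
        have h2 : ∀ k, L (Pi.single x.1 (Pi.single x.2 1)) k = q * (row p ∘ a) k x := by
          intro k
          simp only [L, ContinuousLinearMap.coe_pi', edgeL_apply, ← row_dot]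
          congr 1
          rw [Finset.sum_eq_single x]
          · simp [row]
          · rintro ⟨y, j⟩ _ hne
            rcases eq_or_ne y x.1 with h | h
            · have : j ≠ x.2 := fun h' => hne (Prod.ext h h')
              subst h
              simp [this]
            · simp [h]
          · simp
        simp only [h2, mul_assoc, ← Finset.mul_sum] at h1
        have h3 := (mul_eq_zero.1 h1).resolve_left hq0
        simp only [Finset.sum_apply, Pi.smul_apply, smul_eq_mul, Pi.zero_apply]
        rw [← h3]
        exact Finset.sum_congr rfl fun k _ => mul_comm _ _
      have h4 := Fintype.linearIndependent_iff.1 hli _ hz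
      ext k
      simpa using h4 k
    exact LinearMap.range_eq_top.1 this
  obtain ⟨c, hc0, hcd, hcc, hce⟩ := exists_curve f hf p L hL hsurj u hLu
  have hcont : Tendsto c (𝓝 0) (𝓝 p) := by
    have := hcc.continuousAt.tendsto
    rwa [hc0] at this
  have hdiff : ∀ᶠ t in 𝓝 (0:ℝ), DifferentiableAt ℝ c t := by
    filter_upwards [hcc.eventually (by simp)] with t ht
    exact ht.differentiableAt (by simp)
  obtain ⟨δ, hδ, hball⟩ := Metric.eventually_nhds_iff.1
    (hdiff.and ((hcont.eventually hnear).and hce.eventually_nhds))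
  have hI : ∀ t ∈ Icc (-(δ / 2)) (δ / 2), dist t 0 < δ := by
    intro t ht
    rw [Real.dist_eq, sub_zero, abs_lt]
    constructor <;> [linarith [ht.1]; linarith [ht.2]]
  have h0I : (0:ℝ) ∈ Icc (-(δ / 2)) (δ / 2) := by constructor <;> linarith
  refine ⟨c, δ / 2, by linarith, hc0, hcd,
    fun t ht => (hball (hI t ht)).1.continuousAt.continuousWithinAt, ?_⟩
  intro v w hvw t ht
  have hder : ∀ s ∈ Icc (-(δ / 2)) (δ / 2),
      HasDerivWithinAt (fun s => powSum q (c s v - c s w)) 0 (Icc (-(δ / 2)) (δ / 2)) s := by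
    intro s hs
    obtain ⟨hd, hsp, hev⟩ := hball (hI s hs)
    have hd' := hd.hasDerivAt
    have hE : ∀ v w, HasDerivAt (fun s => powSum q (c s v - c s w))
        (edgeL q (c s) v w (deriv c s)) s := fun v w =>
      (hasFDerivAt_edge hq (c s) v w).comp_hasDerivAt s hd'
    have hzero : ∀ k, pair q (c s (a k).1.1 - c s (a k).1.2)
        (deriv c s (a k).1.1 - deriv c s (a k).1.2) = 0 := by
      intro k
      have h1 := hE (a k).1.1 (a k).1.2
      have h2 : HasDerivAt (fun s => powSum q (c s (a k).1.1 - c s (a k).1.2)) 0 s := by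
        refine (hasDerivAt_const s (f p k)).congr_of_eventuallyEq ?_
        filter_upwards [hev] with r hr
        exact congrFun hr k
      have h3 := h1.unique h2
      rw [edgeL_apply] at h3
      exact (mul_eq_zero.1 h3).resolve_left hq0
    let ℓ : (V × Fin d → ℝ) →ₗ[ℝ] ℝ :=
      ∑ x : V × Fin d, (deriv c s x.1 x.2) • LinearMap.proj x
    have hℓ : ∀ v w, ℓ (rigidityRow q (c s) v w) =
        pair q (c s v - c s w) (deriv c s v - deriv c s w) := by
      intro v w
      rw [← row_dot]
      simp [ℓ, mul_comm]
    have hker : Submodule.span ℝ (Set.range (row (c s) ∘ a)) ≤ LinearMap.ker ℓ := by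
      rw [Submodule.span_le]
      rintro _ ⟨k, rfl⟩
      show ℓ _ = 0
      exact (hℓ _ _).trans (hzero k)
    have h5 : ℓ (rigidityRow q (c s) v w) = 0 := hker (hsp ⟨(v, w), hvw⟩)
    have h6 := hE v w
    rw [edgeL_apply, ← hℓ, h5, mul_zero] at h6
    exact h6.hasDerivWithinAt
  have := (convex_Icc (-(δ / 2)) (δ / 2)).is_const_of_fderivWithin_eq_zero
    (𝕜 := ℝ) (f := fun s => powSum q (c s v - c s w))
    (fun s hs => (hder s hs).differentiableWithinAt) (fun s hs => by
      have hne : -(δ / 2) < δ / 2 := by linarith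
      have := (hder s hs).hasFDerivWithinAt.fderivWithin (uniqueDiffOn_Icc hne s hs)
      rw [this]; ext; simp) ht h0I
  simpa [hc0] using this

theorem statement_7 {V : Type} [Fintype V] {d : ℕ} {q : ℝ} (hq : 1 < q) (hq2 : q ≠ 2)
    (G : SimpleGraph V) (p : V → Fin d → ℝ) (hp : IsPlacement G p)
    (hcoord : ∀ ⦃v w⦄, G.Adj v w → ∀ i, p v i ≠ p w i) :
    (QContRigid q G p ∧ IsRegular q G p) ↔ QInfRigid q G p := by
  rw [qInfRigid_iff hq hq2 G p hp]
  constructor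
  · rintro ⟨hcr, hreg⟩ u hu
    obtain ⟨c, ε, hε, hc0, hcd, hcc, hce⟩ := exists_flex_curve hq G p hreg u hu
    have hmaps : ∀ t ∈ Icc (-1 : ℝ) 1, ε * t ∈ Icc (-ε) ε := by
      intro t ht
      constructor <;> nlinarith [ht.1, ht.2]
    obtain ⟨Γ, hΓ, hα⟩ := hcr (fun v t => c (ε * t) v) ⟨fun v => by
        have h1 : ContinuousOn (fun t => c (ε * t)) (Icc (-1 : ℝ) 1) :=
          hcc.comp (by fun_prop) hmaps
        exact continuousOn_pi.1 h1 v, fun v => by simp [hc0], fun v w hvw t ht =>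
          (qnorm_eq_iff hq _ _).2 (hce v w hvw _ (hmaps t ht))⟩
    intro v w
    have hder : HasDerivAt (fun t => c t v - c t w) (u v - u w) 0 :=
      (hasDerivAt_pi.1 hcd v).sub (hasDerivAt_pi.1 hcd w)
    have hconst : HasDerivAt (fun t => c t v - c t w) 0 0 := by
      refine (hasDerivAt_const (0:ℝ) (p v - p w)).congr_of_eventuallyEq ?_
      filter_upwards [Icc_mem_nhds (neg_lt_zero.2 hε) hε] with t ht
      have ht' : t / ε ∈ Icc (-1 : ℝ) 1 := by
        constructor
        · rw [le_div_iff₀ hε]; linarith [ht.1]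
        · rw [div_le_iff₀ hε]; linarith [ht.2]
      have e : ε * (t / ε) = t := by field_simp
      have hv := hα v _ ht'
      have hw := hα w _ ht'
      simp only [e] at hv hw
      have tv := rigidMotion_translation hq hq2 hΓ (p v) _ ht'
      have tw := rigidMotion_translation hq hq2 hΓ (p w) _ ht'
      rw [hv, hw, eq_add_of_sub_eq tv, eq_add_of_sub_eq tw]
      exact add_sub_add_right_eq_sub _ _ _
    exact sub_eq_zero.1 (hder.unique hconst)
  · intro hker
    refine ⟨?_, regular_of_ker G p hp hker⟩
    rintro α ⟨hc, h0, hα⟩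
    rcases isEmpty_or_nonempty V with hV | ⟨⟨v₀⟩⟩
    · exact ⟨fun x _ => x, ⟨fun _ _ _ _ => rfl, fun _ => continuousOn_const, fun _ => rfl⟩,
        fun v => hV.elim v⟩
    · refine ⟨fun x t => x + (α v₀ t - p v₀), ⟨fun t _ x y => ?_, fun x => ?_, fun x => ?_⟩,
        fun v t ht => ?_⟩
      · congr 1; exact add_sub_add_right_eq_sub _ _ _
      · exact continuousOn_const.add ((hc v₀).sub continuousOn_const)
      · simp [h0]
      · have := contFlex_translation hq G.Adj p hker α hc h0 (fun v w h t ht => hα h t ht)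
          v v₀ t ht
        rw [eq_add_of_sub_eq this]
        funext i
        simp only [Pi.add_apply, Pi.sub_apply]
        ring

end RigidityPaper
end
end

section
/- Let G be a finite (k,l)-sparse loopless multigraph and suppose that either (a) k = 2, l = 3 and G has at least two vertices, or (b) k = l ≥ 1 and G has at least 2k vertices. Then G is (k,l)-tight if and only if every pair of distinct vertices v,w of G with no edge between them is contained in a (k,l)-tight subgraph of G. Moreover, G is a spanning subgraph of some (k,l)-tight multigraph G' obtained from G by adjoining finitely many edges joining distinct vertices of V(G). -/
open Asymptotics Filter Topology Set

open scoped Classical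

noncomputable section

namespace RigidityPaper

variable {V X E : Type}

variable {G : SimpleGraph V}

/-- Edges induced by a vertex set. -/
def ind {V E : Type} (ends : E → Sym2 V) (S : Set V) : Set E := {e | ∀ v ∈ ends e, v ∈ S}

theorem ind_inter {V E : Type} (ends : E → Sym2 V) (A B : Set V) :
    ind ends A ∩ ind ends B = ind ends (A ∩ B) := by
  ext e
  simp only [ind, Set.mem_inter_iff, Set.mem_setOf_eq]
  exact ⟨fun h v hv => ⟨h.1 v hv, h.2 v hv⟩,
    fun h => ⟨fun v hv => (h v hv).1, fun v hv => (h v hv).2⟩⟩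

theorem ind_mono {V E : Type} (ends : E → Sym2 V) {A B : Set V} (h : A ⊆ B) :
    ind ends A ⊆ ind ends B := fun _ he v hv => h (he v hv)

theorem ind_super {V E : Type} [Fintype V] [Fintype E] (ends : E → Sym2 V) (A B : Set V) :
    (ind ends A).ncard + (ind ends B).ncard
      ≤ (ind ends (A ∪ B)).ncard + (ind ends (A ∩ B)).ncard := by
  rw [← Set.ncard_union_add_ncard_inter (ind ends A) (ind ends B), ind_inter]
  have : ind ends A ∪ ind ends B ⊆ ind ends (A ∪ B) :=
    Set.union_subset (ind_mono ends Set.subset_union_left) (ind_mono ends Set.subset_union_right)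
  have := Set.ncard_le_ncard this
  omega

theorem ind_small {V E : Type} [Fintype V] (ends : E → Sym2 V)
    (hloop : ∀ e, ¬ (ends e).IsDiag) (S : Set V) (hS : S.ncard ≤ 1) : ind ends S = ∅ := by
  rw [Set.eq_empty_iff_forall_notMem]
  intro e he
  have h1 := hloop e
  have he' : ∀ v ∈ ends e, v ∈ S := he
  generalize ends e = z at h1 he'
  induction z with
  | _ a b =>
    rw [Set.ncard_le_one_iff] at hS
    exact h1 (Sym2.mk_isDiag_iff.2 (hS (he' a (by simp)) (he' b (by simp))))

theorem core_a {V E : Type} [Fintype V] [Fintype E] (ends : E → Sym2 V)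
    (hloop : ∀ e, ¬ (ends e).IsDiag) (hV : 2 ≤ Fintype.card V)
    (hs : ∀ S : Set V, 2 ≤ S.ncard → (ind ends S).ncard + 3 ≤ 2 * S.ncard)
    (h : ∀ v w : V, v ≠ w → ∃ S : Set V, v ∈ S ∧ w ∈ S ∧ (ind ends S).ncard + 3 = 2 * S.ncard) :
    (ind ends Set.univ).ncard + 3 = 2 * (Set.univ : Set V).ncard := by
  have hun : ∀ A B : Set V, (ind ends A).ncard + 3 = 2 * A.ncard →
      (ind ends B).ncard + 3 = 2 * B.ncard → 2 ≤ (A ∩ B).ncard →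
      (ind ends (A ∪ B)).ncard + 3 = 2 * (A ∪ B).ncard := by
    intro A B hA hB hAB
    have h1 := ind_super ends A B
    have h2 := hs _ hAB
    have h3 := Set.ncard_union_add_ncard_inter A B
    have h4 := hs (A ∪ B) (hAB.trans (Set.ncard_le_ncard
      (Set.inter_subset_left.trans Set.subset_union_left)))
    omega
  have two : ∀ (S : Set V) (x y : V), x ≠ y → x ∈ S → y ∈ S → 2 ≤ S.ncard := by
    intro S x y hxy hx hy
    rw [← Set.ncard_pair hxy]
    exact Set.ncard_le_ncard (by intro z hz; rcases hz with rfl | rfl <;> assumption)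
  obtain ⟨v, w, hvw⟩ := Fintype.one_lt_card_iff.1 hV
  obtain ⟨S0, hv0, hw0, hT0⟩ := h v w hvw
  obtain ⟨A, ⟨hA2, hAT⟩, hmax⟩ := Set.exists_max_image
    {S : Set V | 2 ≤ S.ncard ∧ (ind ends S).ncard + 3 = 2 * S.ncard} Set.ncard (Set.toFinite _)
    ⟨S0, two _ _ _ hvw hv0 hw0, hT0⟩
  have hmax' : ∀ (U : Set V) (x : V), x ∉ A → x ∈ U → A ⊆ U →
      ¬ (ind ends U).ncard + 3 = 2 * U.ncard := by
    intro U x hx hxU hAU hU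
    have h1 := hmax U ⟨hA2.trans (Set.ncard_le_ncard hAU), hU⟩
    have h2 := Set.ncard_lt_ncard (s := A) (t := U) ⟨hAU, fun hh => hx (hh hxU)⟩
    omega
  by_cases hAu : A = Set.univ
  · rw [hAu] at hAT; exact hAT
  exfalso
  obtain ⟨x, hx⟩ := (Set.ne_univ_iff_exists_notMem A).1 hAu
  obtain ⟨a, haA, b, hbA, hab⟩ := (Set.one_lt_ncard_iff_nontrivial).1 hA2
  have hxa : x ≠ a := fun hh => hx (hh ▸ haA)
  have hxb : x ≠ b := fun hh => hx (hh ▸ hbA)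
  obtain ⟨B, hxB, haB, hBT⟩ := h x a hxa
  obtain ⟨C, hxC, hbC, hCT⟩ := h x b hxb
  have hAB : (A ∩ B).ncard ≤ 1 := by
    by_contra hc
    exact hmax' (A ∪ B) x hx (Or.inr hxB) Set.subset_union_left (hun A B hAT hBT (by omega))
  have hAC : (A ∩ C).ncard ≤ 1 := by
    by_contra hc
    exact hmax' (A ∪ C) x hx (Or.inr hxC) Set.subset_union_left (hun A C hAT hCT (by omega))
  have hBC : (B ∩ C).ncard ≤ 1 := by
    by_contra hc
    have hBCT := hun B C hBT hCT (by omega)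
    exact hmax' (A ∪ (B ∪ C)) x hx (Or.inr (Or.inl hxB)) Set.subset_union_left
      (hun A _ hAT hBCT (two _ a b hab ⟨haA, Or.inl haB⟩ ⟨hbA, Or.inr hbC⟩))
  have i1 := ind_small ends hloop _ hAB
  have i2 := ind_small ends hloop _ hAC
  have i3 := ind_small ends hloop _ hBC
  rw [← ind_inter] at i1 i2 i3
  have e1 := Set.ncard_union_add_ncard_inter (ind ends A) (ind ends B)
  have e2 := Set.ncard_union_add_ncard_inter (ind ends A ∪ ind ends B) (ind ends C)
  rw [Set.union_inter_distrib_right, i2, i3] at e2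
  rw [i1] at e1
  simp only [Set.union_empty, Set.ncard_empty, add_zero] at e1 e2
  have v1 := Set.ncard_union_add_ncard_inter A B
  have v2 := Set.ncard_union_add_ncard_inter (A ∪ B) C
  have v3 : 1 ≤ (A ∩ B).ncard := (Set.ncard_pos).2 ⟨a, haA, haB⟩
  have v4 : 2 ≤ ((A ∪ B) ∩ C).ncard := two _ x b hxb ⟨Or.inr hxB, hxC⟩ ⟨Or.inl hbA, hbC⟩
  have hsub : (ind ends A ∪ ind ends B) ∪ ind ends C ⊆ ind ends (A ∪ B ∪ C) := by
    refine Set.union_subset (Set.union_subset ?_ ?_) ?_ <;> apply ind_mono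
    · exact Set.subset_union_left.trans Set.subset_union_left
    · exact Set.subset_union_right.trans Set.subset_union_left
    · exact Set.subset_union_right
  have hsub' := Set.ncard_le_ncard hsub
  have hAU : A ⊆ A ∪ B ∪ C := Set.subset_union_left.trans Set.subset_union_left
  have hU := hs (A ∪ B ∪ C) (hA2.trans (Set.ncard_le_ncard hAU))
  exact hmax' (A ∪ B ∪ C) x hx (Or.inr hxC) hAU (by omega)

/-- A set of vertices all joined to `x` has at most as many elements as edges at `x` to it. -/
theorem cross {V E : Type} [Fintype V] [Fintype E] (ends : E → Sym2 V) (x : V) (B : Set V)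
    (h : ∀ y ∈ B, ∃ e, ends e = s(x, y)) :
    B.ncard ≤ {e | ∃ y ∈ B, ends e = s(x, y)}.ncard := by
  rcases B.eq_empty_or_nonempty with rfl | ⟨y0, hy0⟩
  · simp
  haveI : Nonempty E := ⟨(h y0 hy0).choose⟩
  choose! f hf using h
  refine Set.ncard_le_ncard_of_injOn f (fun y hy => ⟨y, hy, hf y hy⟩) ?_
  intro y hy z hz hyz
  have h1 := hf y hy
  rw [hyz, hf z hz] at h1
  have h2 : y = z ∨ x = z ∧ y = x := by simpa using h1.symm
  rcases h2 with h2 | ⟨h2, h3⟩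
  · exact h2
  · exact h3.trans h2

theorem handshake {V E : Type} [Fintype V] [Fintype E] (ends : E → Sym2 V) (d : ℕ)
    (h : ∀ v, d ≤ {e | v ∈ ends e}.ncard) : Fintype.card V * d ≤ Fintype.card E * 2 := by
  have key := Finset.sum_card_bipartiteAbove_eq_sum_card_bipartiteBelow
    (s := (Finset.univ : Finset V)) (t := (Finset.univ : Finset E)) (fun v e => v ∈ ends e)
  have h1 : Fintype.card V * d ≤
      ∑ v : V, (Finset.univ.bipartiteAbove (fun v e => v ∈ ends e) v : Finset E).card := by
    rw [← Finset.card_univ, ← smul_eq_mul]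
    refine Finset.card_nsmul_le_sum _ _ _ fun v _ => ?_
    refine (h v).trans (le_of_eq ?_)
    rw [Set.ncard_eq_toFinset_card']
    congr 1
    ext e
    simp [Finset.bipartiteAbove]
  have h2 : ∑ e : E, (Finset.univ.bipartiteBelow (fun v e => v ∈ ends e) e : Finset V).card
      ≤ Fintype.card E * 2 := by
    rw [← Finset.card_univ, ← smul_eq_mul]
    refine Finset.sum_le_card_nsmul _ _ _ fun e _ => ?_
    rw [Finset.bipartiteBelow]
    generalize ends e = z
    induction z with
    | _ a b =>
      refine le_trans (Finset.card_le_card (t := {a, b}) ?_) Finset.card_le_two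
      intro v hv
      simpa using hv
  omega

theorem core_b {V E : Type} [Fintype V] [Fintype E] (k : ℕ) (hk : 1 ≤ k) (ends : E → Sym2 V)
    (hloop : ∀ e, ¬ (ends e).IsDiag) (hV : 2 * k ≤ Fintype.card V)
    (hs : ∀ S : Set V, 2 ≤ S.ncard → (ind ends S).ncard + k ≤ k * S.ncard)
    (h : ∀ v w : V, v ≠ w → (¬ ∃ e, ends e = s(v, w)) →
      ∃ S : Set V, v ∈ S ∧ w ∈ S ∧ (ind ends S).ncard + k = k * S.ncard) :
    (ind ends Set.univ).ncard + k = k * (Set.univ : Set V).ncard := by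
  have hs1 : ∀ S : Set V, 1 ≤ S.ncard → (ind ends S).ncard + k ≤ k * S.ncard := by
    intro S hS
    rcases hS.lt_or_eq with h1 | h1
    · exact hs S h1
    · rw [ind_small ends hloop S h1.symm.le, ← h1]; simp
  have huniv : (Set.univ : Set V).ncard = Fintype.card V := by
    rw [Set.ncard_univ, Nat.card_eq_fintype_card]
  by_contra hnt
  have hun : ∀ A B : Set V, (ind ends A).ncard + k = k * A.ncard →
      (ind ends B).ncard + k = k * B.ncard → 1 ≤ (A ∩ B).ncard →
      (ind ends (A ∪ B)).ncard + k = k * (A ∪ B).ncard := by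
    intro A B hA hB hAB
    have h1 := ind_super ends A B
    have h2 := hs1 _ hAB
    have h3 := Set.ncard_union_add_ncard_inter A B
    have h4 := hs1 (A ∪ B) (hAB.trans (Set.ncard_le_ncard
      (Set.inter_subset_left.trans Set.subset_union_left)))
    have h5 : k * (A ∪ B).ncard + k * (A ∩ B).ncard = k * A.ncard + k * B.ncard := by
      rw [← mul_add, ← mul_add, h3]
    omega
  have hdeg : ∀ v : V, Fintype.card V - 1 ≤ {e | v ∈ ends e}.ncard := by
    intro v
    obtain ⟨A, ⟨hvA, hAT⟩, hmax⟩ := Set.exists_max_image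
      {S : Set V | v ∈ S ∧ (ind ends S).ncard + k = k * S.ncard} Set.ncard (Set.toFinite _)
      ⟨{v}, rfl, by rw [ind_small ends hloop {v} (by simp)]; simp⟩
    have hmax' : ∀ (U : Set V) (x : V), x ∉ A → x ∈ U → A ⊆ U →
        ¬ (ind ends U).ncard + k = k * U.ncard := by
      intro U x hx hxU hAU hU
      have h1 := hmax U ⟨hAU hvA, hU⟩
      have h2 := Set.ncard_lt_ncard (s := A) (t := U) ⟨hAU, fun hh => hx (hh hxU)⟩
      omega
    have hadj : ∀ x ∈ A, ∀ y, y ∉ A → ∃ e, ends e = s(x, y) := by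
      intro x hx y hy
      by_contra hc
      obtain ⟨B, hxB, hyB, hBT⟩ := h x y (fun hh => hy (hh ▸ hx)) hc
      exact hmax' (A ∪ B) y hy (Or.inr hyB) Set.subset_union_left
        (hun A B hAT hBT ((Set.ncard_pos).2 ⟨x, hx, hxB⟩))
    have hA1 : 1 ≤ A.ncard := (Set.ncard_pos).2 ⟨v, hvA⟩
    have hcompl := Set.ncard_add_ncard_compl A
    rw [Nat.card_eq_fintype_card] at hcompl
    have hAk : A.ncard < k := by
      by_contra hc
      have hAu : A ≠ Set.univ := by rintro rfl; exact hnt hAT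
      obtain ⟨y, hy⟩ := (Set.ne_univ_iff_exists_notMem A).1 hAu
      have hcr := cross ends y A (fun x hx => by
        obtain ⟨e, he⟩ := hadj x hx y hy
        exact ⟨e, by rw [he, Sym2.eq_swap]⟩)
      set D : Set E := {e | ∃ x ∈ A, ends e = s(y, x)} with hD
      have hdis : Disjoint (ind ends A) D := by
        rw [Set.disjoint_left]
        rintro e he ⟨x, hx, hex⟩
        exact hy (he y (by rw [hex]; simp))
      have hsub : ind ends A ∪ D ⊆ ind ends (insert y A) := by
        refine Set.union_subset (ind_mono ends (Set.subset_insert _ _)) ?_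
        rintro e ⟨x, hx, hex⟩ z hz
        rw [hex, Sym2.mem_iff] at hz
        rcases hz with rfl | rfl
        · exact Or.inl rfl
        · exact Or.inr hx
      have h1 := Set.ncard_le_ncard hsub
      rw [Set.ncard_union_eq hdis] at h1
      have h2 : (insert y A).ncard = A.ncard + 1 := Set.ncard_insert_of_notMem hy
      have h3 := hs1 (insert y A) (by omega)
      refine hmax' (insert y A) y hy (Or.inl rfl) (Set.subset_insert _ _) ?_
      rw [h2, mul_add, mul_one] at h3 ⊢
      omega
    have hcr := cross ends v Aᶜ (fun y hy => hadj v hvA y hy)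
    set D : Set E := {e | ∃ x ∈ Aᶜ, ends e = s(v, x)} with hD
    have hDsub : D ⊆ {e | v ∈ ends e} := by
      rintro e ⟨x, hx, hex⟩
      simp [hex]
    rcases hA1.lt_or_eq with hA2 | hA1'
    · have hdiff : (A \ {v}).ncard + 1 = A.ncard := Set.ncard_diff_singleton_add_one hvA
      have h1 := hs1 (A \ {v}) (by omega)
      have h2 : ind ends A ⊆ ind ends (A \ {v}) ∪ (ind ends A ∩ {e | v ∈ ends e}) := by
        intro e he
        by_cases hve : v ∈ ends e
        · exact Or.inr ⟨he, hve⟩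
        · refine Or.inl fun z hz => ⟨he z hz, ?_⟩
          rintro rfl
          exact hve hz
      have h3 := (Set.ncard_le_ncard h2).trans (Set.ncard_union_le _ _)
      have hdis : Disjoint (ind ends A ∩ {e | v ∈ ends e}) D := by
        rw [Set.disjoint_left]
        rintro e ⟨he, _⟩ ⟨x, hx, hex⟩
        exact hx (he x (by rw [hex]; simp))
      have h4 := Set.ncard_le_ncard (Set.union_subset
        (Set.inter_subset_right : ind ends A ∩ {e | v ∈ ends e} ⊆ {e | v ∈ ends e}) hDsub)
      rw [Set.ncard_union_eq hdis] at h4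
      rw [← hdiff, mul_add, mul_one] at hAT
      omega
    · have h4 := Set.ncard_le_ncard hDsub
      omega
  have hh := handshake ends _ hdeg
  have hu := hs1 Set.univ (by rw [huniv]; omega)
  have hE : (ind ends (Set.univ : Set V)).ncard = Fintype.card E := by
    have : ind ends (Set.univ : Set V) = Set.univ := by
      ext e; simp [ind]
    rw [this, Set.ncard_univ, Nat.card_eq_fintype_card]
  rw [hE, huniv] at hu hnt
  obtain ⟨n, hn⟩ : ∃ n, Fintype.card V = n + 1 := ⟨Fintype.card V - 1, by omega⟩
  rw [hn] at hh hu hnt hV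
  simp only [Nat.add_sub_cancel] at hh
  have : 2 * k * n ≤ (n + 1) * n := Nat.mul_le_mul_right _ hV
  rw [mul_add, mul_one] at hu hnt
  apply hnt
  have h5 : 2 * k * n = 2 * (k * n) := by ring
  omega

theorem main1 {V E : Type} [Fintype V] [Fintype E] (k l : ℕ) (hk : 1 ≤ k)
    (ends : E → Sym2 V) (hloop : ∀ e, ¬ (ends e).IsDiag)
    (hsparse : MGSparseOn k l ends univ univ)
    (hcase : (k = 2 ∧ l = 3 ∧ 2 ≤ Fintype.card V) ∨ (k = l ∧ 2 * k ≤ Fintype.card V))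
    (h : ∀ v w : V, v ≠ w → (¬ ∃ e, ends e = s(v, w)) →
        ∃ (V' : Set V) (E' : Set E), MGSubgraph ends V' E' ∧ v ∈ V' ∧ w ∈ V' ∧
          MGTightOn k l ends V' E') : MGTightOn k l ends univ univ := by
  have hs : ∀ S : Set V, 2 ≤ S.ncard → (ind ends S).ncard + l ≤ k * S.ncard := by
    intro S hS
    have := hsparse S (ind ends S) (subset_univ _) (subset_univ _) (fun e he => he) hS
    have : (((ind ends S).ncard + l : ℕ) : ℤ) ≤ ((k * S.ncard : ℕ) : ℤ) := by
      push_cast; linarith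
    exact_mod_cast this
  have two : ∀ (S : Set V) (x y : V), x ≠ y → x ∈ S → y ∈ S → 2 ≤ S.ncard := by
    intro S x y hxy hx hy
    rw [← Set.ncard_pair hxy]
    exact Set.ncard_le_ncard (by intro z hz; rcases hz with rfl | rfl <;> assumption)
  have h' : ∀ v w : V, v ≠ w → (¬ ∃ e, ends e = s(v, w)) →
      ∃ S : Set V, v ∈ S ∧ w ∈ S ∧ (ind ends S).ncard + l = k * S.ncard := by
    intro v w hvw hn
    obtain ⟨V', E', hsub, hv, hw, -, hT⟩ := h v w hvw hn
    refine ⟨V', hv, hw, le_antisymm (hs _ (two _ _ _ hvw hv hw)) ?_⟩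
    have h1 : E'.ncard ≤ (ind ends V').ncard := Set.ncard_le_ncard (fun e he => hsub e he)
    have : ((k * V'.ncard : ℕ) : ℤ) = ((E'.ncard + l : ℕ) : ℤ) := by
      push_cast; linarith
    have : k * V'.ncard = E'.ncard + l := by exact_mod_cast this
    omega
  have hfin : (ind ends Set.univ).ncard + l = k * (Set.univ : Set V).ncard := by
    rcases hcase with ⟨rfl, rfl, hV⟩ | ⟨rfl, hV⟩
    · refine core_a ends hloop hV hs fun v w hvw => ?_
      by_cases hn : ∃ e, ends e = s(v, w)
      · obtain ⟨e, he⟩ := hn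
        refine ⟨{v, w}, by simp, by simp, ?_⟩
        have h2 : ({v, w} : Set V).ncard = 2 := Set.ncard_pair hvw
        have h1 := hs {v, w} h2.ge
        have h3 : 1 ≤ (ind ends {v, w}).ncard := (Set.ncard_pos).2 ⟨e, fun z hz => by
          rw [he] at hz; simpa using hz⟩
        omega
      · exact h' v w hvw hn
    · exact core_b k hk ends hloop hV hs h'
  refine ⟨hsparse, ?_⟩
  have hE : ind ends (Set.univ : Set V) = Set.univ := by
    ext e; simp [ind]
  rw [hE] at hfin
  have : (((univ : Set E).ncard + l : ℕ) : ℤ) = ((k * (univ : Set V).ncard : ℕ) : ℤ) := by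
    rw [hfin]
  push_cast at this
  linarith

theorem addEdge {V E : Type} [Fintype V] [Fintype E] (k l m : ℕ)
    (ends : E → Sym2 V) (f : Fin m → Sym2 V) (v w : V)
    (hsparse : MGSparseOn k l (Sum.elim ends f) univ univ)
    (hn : ¬ ∃ (V' : Set V) (E' : Set (E ⊕ Fin m)), MGSubgraph (Sum.elim ends f) V' E' ∧
      v ∈ V' ∧ w ∈ V' ∧ MGTightOn k l (Sum.elim ends f) V' E') :
    MGSparseOn k l (Sum.elim ends (Fin.snoc (α := fun _ => Sym2 V) f s(v, w))) univ univ := by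
  intro V' E' _ _ hsub hV
  set i : E ⊕ Fin m → E ⊕ Fin (m + 1) := Sum.map id Fin.castSucc with hi
  have hiinj : Function.Injective i :=
    Function.Injective.sumMap Function.injective_id (Fin.castSucc_injective m)
  have hends : ∀ e, Sum.elim ends (Fin.snoc (α := fun _ => Sym2 V) f s(v, w)) (i e)
      = Sum.elim ends f e := by
    rintro (e | e) <;> simp [hi]
  have hsub0 : MGSubgraph (Sum.elim ends f) V' (i ⁻¹' E') := by
    intro e he x hx
    exact hsub (i e) he x (by rw [hends]; exact hx)
  have hle := hsparse V' (i ⁻¹' E') (subset_univ _) (subset_univ _) hsub0 hV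
  have himg : (i '' (i ⁻¹' E')).ncard = (i ⁻¹' E').ncard := Set.ncard_image_of_injective _ hiinj
  have hcov : ∀ e ∈ E', e = Sum.inr (Fin.last m) ∨ e ∈ i '' (i ⁻¹' E') := by
    rintro (e | e) he
    · exact Or.inr ⟨Sum.inl e, he, rfl⟩
    · induction e using Fin.lastCases with
      | last => exact Or.inl rfl
      | cast j => exact Or.inr ⟨Sum.inr j, he, rfl⟩
  by_cases hlast : Sum.inr (Fin.last m) ∈ E'
  · have hvw : ∀ x ∈ s(v, w), x ∈ V' := by
      intro x hx
      exact hsub _ hlast x (by simpa using hx)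
    have hcard : E'.ncard ≤ (i ⁻¹' E').ncard + 1 := by
      rw [← himg]
      refine le_trans (Set.ncard_le_ncard (t := insert (Sum.inr (Fin.last m)) (i '' (i ⁻¹' E')))
        (fun e he => hcov e he)) (Set.ncard_insert_le _ _)
    have hne : ((i ⁻¹' E').ncard : ℤ) ≠ (k * V'.ncard : ℤ) - l := by
      intro heq
      refine hn ⟨V', i ⁻¹' E', hsub0, hvw v (by simp), hvw w (by simp), ?_, heq⟩
      intro V2 E2 _ _ h3 h4
      exact hsparse V2 E2 (subset_univ _) (subset_univ _) h3 h4
    have hlt := lt_of_le_of_ne hle hne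
    have : (E'.ncard : ℤ) ≤ (i ⁻¹' E').ncard + 1 := by exact_mod_cast hcard
    omega
  · have hcard : E'.ncard ≤ (i ⁻¹' E').ncard := by
      rw [← himg]
      refine Set.ncard_le_ncard (fun e he => (hcov e he).resolve_left ?_)
      rintro rfl
      exact hlast he
    have : (E'.ncard : ℤ) ≤ (i ⁻¹' E').ncard := by exact_mod_cast hcard
    omega

theorem statement_8 {V E : Type} [Fintype V] [Fintype E] (k l : ℕ) (hk : 1 ≤ k) (hl : 1 ≤ l)
    (ends : E → Sym2 V) (hloop : ∀ e, ¬ (ends e).IsDiag)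
    (hsparse : MGSparseOn k l ends univ univ)
    (hcase : (k = 2 ∧ l = 3 ∧ 2 ≤ Fintype.card V) ∨ (k = l ∧ 2 * k ≤ Fintype.card V)) :
    (MGTightOn k l ends univ univ ↔
      ∀ v w : V, v ≠ w → (¬ ∃ e, ends e = s(v, w)) →
        ∃ (V' : Set V) (E' : Set E), MGSubgraph ends V' E' ∧ v ∈ V' ∧ w ∈ V' ∧
          MGTightOn k l ends V' E') ∧
    ∃ (F : Type) (_ : Fintype F) (ends' : E ⊕ F → Sym2 V),
      (∀ e, ends' (Sum.inl e) = ends e) ∧ (∀ f, ¬ (ends' (Sum.inr f)).IsDiag) ∧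
      MGTightOn k l ends' univ univ := by
  refine ⟨⟨fun h v w _ _ => ⟨univ, univ, fun _ _ _ _ => mem_univ _, mem_univ _, mem_univ _, h⟩,
    main1 k l hk ends hloop hsparse hcase⟩, ?_⟩
  have hV2 : 2 ≤ Fintype.card V := by rcases hcase with h | h <;> omega
  have huniv : (Set.univ : Set V).ncard = Fintype.card V := by
    rw [Set.ncard_univ, Nat.card_eq_fintype_card]
  let P : ℕ → Prop := fun m => ∃ f : Fin m → Sym2 V, (∀ j, ¬ (f j).IsDiag) ∧
    MGSparseOn k l (Sum.elim ends f) univ univ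
  have hbound : ∀ m, P m → m ≤ k * Fintype.card V := by
    rintro m ⟨f, -, hf⟩
    have h1 := hf univ univ (subset_univ _) (subset_univ _) (fun _ _ _ _ => mem_univ _)
      (by rw [huniv]; exact hV2)
    rw [huniv, Set.ncard_univ, Nat.card_eq_fintype_card, Fintype.card_sum, Fintype.card_fin] at h1
    push_cast at h1
    have : (m : ℤ) ≤ ((k * Fintype.card V : ℕ) : ℤ) := by push_cast; omega
    exact_mod_cast this
  have hP0 : P 0 := by
    refine ⟨Fin.elim0, fun j => j.elim0, ?_⟩
    intro V' E' _ _ hsub hV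
    have h1 := hsparse V' (Sum.inl ⁻¹' E') (subset_univ _) (subset_univ _)
      (fun e he x hx => hsub (Sum.inl e) he x hx) hV
    have h2 : E' ⊆ Sum.inl '' ((Sum.inl : E → E ⊕ Fin 0) ⁻¹' E') := by
      rintro (e | e) he
      · exact ⟨e, he, rfl⟩
      · exact e.elim0
    have h3 := (Set.ncard_le_ncard h2).trans
      (Set.ncard_image_of_injective _ Sum.inl_injective).le
    have : (E'.ncard : ℤ) ≤ ((Sum.inl : E → E ⊕ Fin 0) ⁻¹' E').ncard := by exact_mod_cast h3
    omega
  obtain ⟨m, hm, hmax⟩ : ∃ m, P m ∧ ¬ P (m + 1) := by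
    by_contra hc
    push Not at hc
    have : ∀ m, P m := fun m => Nat.rec hP0 hc m
    have := hbound _ (this (k * Fintype.card V + 1))
    omega
  obtain ⟨f, hf, hfs⟩ := hm
  refine ⟨Fin m, inferInstance, Sum.elim ends f, fun _ => rfl, hf, ?_⟩
  refine main1 k l hk _ ?_ hfs hcase ?_
  · rintro (e | e)
    · exact hloop e
    · exact hf e
  · intro v w hvw _
    by_contra hn
    refine hmax ⟨Fin.snoc (α := fun _ => Sym2 V) f s(v, w), ?_, addEdge k l m ends f v w hfs hn⟩
    intro j
    induction j using Fin.lastCases with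
    | last => simpa using hvw
    | cast j => simpa using hf j

end RigidityPaper
end
end

section
/- Let G ⊆ G' be an inclusion of finite simple graphs, both of which are (2,3)-tight. Then there exists a finite sequence of simple graphs G = G₁, G₂, …, G_n = G' such that for each k, G_{k+1} is obtained from G_k by either a Henneberg vertex extension move of degree 2 or a Henneberg edge move of degree 2. -/
open Asymptotics Filter Topology Set

open scoped Classical

noncomputable section

namespace RigidityPaper

variable {V X E : Type}

variable {G : SimpleGraph V}

/-- Edges of `F` spanned by `S`. -/
def eIn (F : Finset (Sym2 V)) (S : Finset V) : Finset (Sym2 V) :=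
  F.filter (fun e => ∀ x ∈ e, x ∈ S)

/-- Finset version of sparsity. -/
def FSparse (F : Finset (Sym2 V)) (W : Finset V) : Prop :=
  ∀ S : Finset V, S ⊆ W → 2 ≤ S.card → (eIn F S).card + 3 ≤ 2 * S.card

lemma mem_eIn (F : Finset (Sym2 V)) (S : Finset V) (e : Sym2 V) :
    e ∈ eIn F S ↔ e ∈ F ∧ ∀ x ∈ e, x ∈ S := by
  simp [eIn]

lemma eIn_super (F : Finset (Sym2 V)) (S T : Finset V) :
    (eIn F S).card + (eIn F T).card ≤ (eIn F (S ∪ T)).card + (eIn F (S ∩ T)).card := by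
  have h1 : eIn F S ∪ eIn F T ⊆ eIn F (S ∪ T) := by
    intro e he
    simp only [Finset.mem_union, mem_eIn] at he ⊢
    rcases he with he | he
    · exact ⟨he.1, fun x hx => Or.inl (he.2 x hx)⟩
    · exact ⟨he.1, fun x hx => Or.inr (he.2 x hx)⟩
  have h2 : eIn F S ∩ eIn F T = eIn F (S ∩ T) := by
    ext e
    simp only [Finset.mem_inter, mem_eIn]
    grind
  have h3 := Finset.card_union_add_card_inter (eIn F S) (eIn F T)
  rw [h2] at h3
  have := Finset.card_le_card h1
  omega

lemma eIn_small (F : Finset (Sym2 V)) (hF : ∀ e ∈ F, ¬ e.IsDiag) (S : Finset V)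
    (hS : S.card ≤ 1) : eIn F S = ∅ := by
  rw [Finset.eq_empty_iff_forall_notMem]
  intro e he
  rw [mem_eIn] at he
  induction e using Sym2.ind with
  | _ x y =>
    have hx := he.2 x (by simp)
    have hy := he.2 y (by simp)
    have := Finset.card_le_one.1 hS x hx y hy
    exact hF _ he.1 (by simpa using this)

lemma full_bound (F : Finset (Sym2 V)) (W : Finset V) (hs : FSparse F W)
    (v a b c : V) (hv : v ∈ W) (hab : a ≠ b) (hac : a ≠ c) (hbc : b ≠ c)
    (ha : s(v, a) ∈ F) (hb : s(v, b) ∈ F) (hc : s(v, c) ∈ F)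
    (S : Finset V) (hS : S ⊆ W.erase v) (haS : a ∈ S) (hbS : b ∈ S) (hcS : c ∈ S) :
    (eIn F S).card + 4 ≤ 2 * S.card := by
  have hvS : v ∉ S := fun h => by simpa using hS h
  have h1 := hs (insert v S) (by
    intro x hx
    rcases Finset.mem_insert.1 hx with rfl | hx
    · exact hv
    · exact Finset.mem_of_mem_erase (hS hx)) (by
    rw [Finset.card_insert_of_notMem hvS]
    have := Finset.card_pos.2 ⟨a, haS⟩
    omega)
  rw [Finset.card_insert_of_notMem hvS] at h1
  have h2 : eIn F S ∪ {s(v, a), s(v, b), s(v, c)} ⊆ eIn F (insert v S) := by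
    intro e he
    simp only [Finset.mem_union, Finset.mem_insert, Finset.mem_singleton] at he
    rw [mem_eIn]
    rcases he with he | rfl | rfl | rfl
    · rw [mem_eIn] at he
      exact ⟨he.1, fun x hx => Finset.mem_insert_of_mem (he.2 x hx)⟩
    all_goals
      refine ⟨by assumption, ?_⟩
      intro x hx
      rcases Sym2.mem_iff.1 hx with rfl | rfl <;> simp [*]
  have h3 : Disjoint (eIn F S) {s(v, a), s(v, b), s(v, c)} := by
    rw [Finset.disjoint_right]
    intro e he he'
    rw [mem_eIn] at he'
    apply hvS
    apply he'.2
    simp only [Finset.mem_insert, Finset.mem_singleton] at he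
    rcases he with rfl | rfl | rfl <;> simp
  have h4 : ({s(v, a), s(v, b), s(v, c)} : Finset (Sym2 V)).card = 3 := by
    rw [Finset.card_eq_three]
    refine ⟨_, _, _, ?_, ?_, ?_, rfl⟩ <;> simp [*] <;> grind
  have := Finset.card_le_card h2
  rw [Finset.card_union_of_disjoint h3, h4] at this
  omega

/-- the pair `a b` can be added -/
def FreePair (F : Finset (Sym2 V)) (U : Finset V) (a b : V) : Prop :=
  ∀ S : Finset V, S ⊆ U → a ∈ S → b ∈ S → (eIn F S).card + 4 ≤ 2 * S.card

lemma inter_small (F : Finset (Sym2 V)) (W : Finset V) (hs : FSparse F W)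
    (v a b c : V) (hv : v ∈ W) (hab : a ≠ b) (hac : a ≠ c) (hbc : b ≠ c)
    (ha : s(v, a) ∈ F) (hb : s(v, b) ∈ F) (hc : s(v, c) ∈ F)
    (S T : Finset V) (hS : S ⊆ W.erase v) (hT : T ⊆ W.erase v)
    (haS : a ∈ S) (hbS : b ∈ S) (hbT : b ∈ T) (hcT : c ∈ T)
    (hS3 : 2 * S.card ≤ (eIn F S).card + 3) (hT3 : 2 * T.card ≤ (eIn F T).card + 3) :
    (S ∩ T).card ≤ 1 := by
  by_contra hcon
  have h1 := hs (S ∩ T) (fun x hx => Finset.mem_of_mem_erase (hS (Finset.mem_inter.1 hx).1))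
    (by omega)
  have h2 := full_bound F W hs v a b c hv hab hac hbc ha hb hc (S ∪ T)
    (Finset.union_subset hS hT) (by simp [*]) (by simp [*]) (by simp [*])
  have h3 := eIn_super F S T
  have h4 := Finset.card_union_add_card_inter S T
  omega

lemma exists_free (F : Finset (Sym2 V)) (hF : ∀ e ∈ F, ¬ e.IsDiag)
    (W : Finset V) (hs : FSparse F W)
    (v a b c : V) (hv : v ∈ W) (hab : a ≠ b) (hac : a ≠ c) (hbc : b ≠ c)
    (ha : s(v, a) ∈ F) (hb : s(v, b) ∈ F) (hc : s(v, c) ∈ F) :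
    FreePair F (W.erase v) a b ∨ FreePair F (W.erase v) b c ∨ FreePair F (W.erase v) a c := by
  by_contra hcon
  unfold FreePair at hcon
  push Not at hcon
  obtain ⟨⟨S, hS, haS, hbS, hS3⟩, ⟨T, hT, hbT, hcT, hT3⟩, ⟨R, hR, haR, hcR, hR3⟩⟩ := hcon
  have i1 := inter_small F W hs v a b c hv hab hac hbc ha hb hc S T hS hT haS hbS hbT hcT
    (by omega) (by omega)
  have i2 := inter_small F W hs v a c b hv hac hab hbc.symm ha hc hb R T hR hT haR hcR hcT hbT
    (by omega) (by omega)
  have i3 := inter_small F W hs v b a c hv hab.symm hbc hac hb ha hc S R hS hR hbS haS haR hcR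
    (by omega) (by omega)
  have key : ∀ A B : Finset V, (A ∩ B).card ≤ 1 → Disjoint (eIn F A) (eIn F B) := by
    intro A B h
    have h0 := eIn_small F hF _ h
    rw [Finset.disjoint_left]
    intro e h1 h2
    have : e ∈ eIn F (A ∩ B) := by
      rw [mem_eIn] at *
      exact ⟨h1.1, fun x hx => Finset.mem_inter.2 ⟨h1.2 x hx, h2.2 x hx⟩⟩
    simp [h0] at this
  have d1 := key _ _ i1
  have d2 := key _ _ i2
  have d3 := key _ _ i3
  have hsub : (eIn F S ∪ eIn F T) ∪ eIn F R ⊆ eIn F ((S ∪ T) ∪ R) := by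
    intro e he
    simp only [Finset.mem_union, mem_eIn] at he ⊢
    grind
  have hc1 := Finset.card_le_card hsub
  rw [Finset.card_union_of_disjoint (by
      rw [Finset.disjoint_union_left]; exact ⟨d3, d2.symm⟩),
    Finset.card_union_of_disjoint d1] at hc1
  have hfull := full_bound F W hs v a b c hv hab hac hbc ha hb hc ((S ∪ T) ∪ R)
    (Finset.union_subset (Finset.union_subset hS hT) hR) (by simp [*]) (by simp [*]) (by simp [*])
  have h4 := Finset.card_union_add_card_inter S T
  have h5 := Finset.card_union_add_card_inter (S ∪ T) R
  have h6 : 1 ≤ (S ∩ T).card := Finset.card_pos.2 ⟨b, by simp [*]⟩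
  have h7 : 2 ≤ ((S ∪ T) ∩ R).card := by
    rw [← Finset.card_pair hac]
    apply Finset.card_le_card
    intro x hx
    simp only [Finset.mem_insert, Finset.mem_singleton] at hx
    rcases hx with rfl | rfl <;> simp [*]
  omega

lemma exists_low_degree (F : Finset (Sym2 V)) (hF : ∀ e ∈ F, ¬ e.IsDiag)
    (W S : Finset V) (hs : FSparse F W) (hFW : ∀ e ∈ F, ∀ x ∈ e, x ∈ W)
    (hcard : F.card + 3 = 2 * W.card) (hSW : S ⊂ W)
    (hScard : (eIn F S).card + 3 = 2 * S.card) :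
    ∃ v ∈ W \ S, (F.filter (fun e => v ∈ e)).card ≤ 3 := by
  by_contra hcon
  push Not at hcon
  have hD : 0 < (W \ S).card := Finset.card_pos.2 (by
    obtain ⟨x, hx, hx'⟩ := Finset.exists_of_ssubset hSW
    exact ⟨x, by simp [*]⟩)
  have hDc : (W \ S).card + S.card = W.card := Finset.card_sdiff_add_card_eq_card hSW.subset
  have h1 : (W \ S).card * 4 ≤ ∑ v ∈ W \ S, (F.filter (fun e => v ∈ e)).card :=
    Finset.card_nsmul_le_sum _ _ 4 (fun v hv => hcon v hv)
  have h2 : ∑ v ∈ W \ S, (F.filter (fun e => v ∈ e)).card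
      = ∑ e ∈ F, ((W \ S).filter (fun v => v ∈ e)).card :=
    Finset.sum_card_bipartiteAbove_eq_sum_card_bipartiteBelow (fun v e => v ∈ e)
  have h3 : ∀ e ∈ F, ((W \ S).filter (fun v => v ∈ e)).card + (if ∀ x ∈ e, x ∈ S then 1 else 0)
      ≤ 1 + (if ∀ x ∈ e, x ∈ W \ S then 1 else 0) := by
    intro e he
    induction e using Sym2.ind with
    | _ x y =>
      have hx := hFW _ he x (by simp)
      have hy := hFW _ he y (by simp)
      have hsub : (W \ S).filter (fun v => v ∈ s(x, y)) =
          ({x, y} : Finset V).filter (fun v => v ∉ S) := by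
        ext z
        simp only [Finset.mem_filter, Finset.mem_sdiff, Sym2.mem_iff, Finset.mem_insert,
          Finset.mem_singleton]
        grind
      rw [hsub]
      have hle : (({x, y} : Finset V).filter (fun v => v ∉ S)).card ≤ 2 :=
        (Finset.card_filter_le _ _).trans Finset.card_le_two
      by_cases hxS : x ∈ S <;> by_cases hyS : y ∈ S <;>
        simp [Finset.filter_insert, Finset.filter_singleton, hxS, hyS, hx, hy]
      exact Finset.card_le_two
  have h4 := Finset.sum_le_sum h3
  rw [Finset.sum_add_distrib, Finset.sum_add_distrib, ← Finset.card_filter, ← Finset.card_filter,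
    Finset.sum_const] at h4
  change _ + (eIn F S).card ≤ F.card • 1 + (eIn F (W \ S)).card at h4
  simp only [smul_eq_mul, mul_one] at h4
  have h5 : (eIn F (W \ S)).card + 2 ≤ 2 * (W \ S).card := by
    by_cases h : (W \ S).card ≤ 1
    · rw [eIn_small F hF _ h]
      rw [Finset.card_empty]; omega
    · have := hs (W \ S) Finset.sdiff_subset (by omega)
      omega
  omega

section Graph

variable [Fintype V]

/-- edges as a finset -/
def FE (H : (⊤ : SimpleGraph V).Subgraph) : Finset (Sym2 V) := (Set.toFinite H.edgeSet).toFinset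

/-- vertices as a finset -/
def FV (H : (⊤ : SimpleGraph V).Subgraph) : Finset V := (Set.toFinite H.verts).toFinset

lemma mem_FE (H : (⊤ : SimpleGraph V).Subgraph) (e : Sym2 V) : e ∈ FE H ↔ e ∈ H.edgeSet := by
  simp [FE]

lemma mem_FE' (H : (⊤ : SimpleGraph V).Subgraph) (a b : V) : s(a, b) ∈ FE H ↔ H.Adj a b := by
  simp [FE]

lemma mem_FV (H : (⊤ : SimpleGraph V).Subgraph) (e : V) : e ∈ FV H ↔ e ∈ H.verts := by
  simp [FV]

lemma card_FE (H : (⊤ : SimpleGraph V).Subgraph) : H.edgeSet.ncard = (FE H).card :=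
  Set.ncard_eq_toFinset_card _ _

lemma card_FV (H : (⊤ : SimpleGraph V).Subgraph) : H.verts.ncard = (FV H).card :=
  Set.ncard_eq_toFinset_card _ _

lemma FE_nd (H : (⊤ : SimpleGraph V).Subgraph) : ∀ e ∈ FE H, ¬ e.IsDiag := by
  intro e
  induction e using Sym2.ind with
  | _ x y =>
    rw [mem_FE']
    intro h
    simpa using h.ne

lemma FE_in (H : (⊤ : SimpleGraph V).Subgraph) : ∀ e ∈ FE H, ∀ x ∈ e, x ∈ FV H := by
  intro e
  induction e using Sym2.ind with
  | _ x y =>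
    rw [mem_FE']
    intro h z hz
    rw [mem_FV]
    rcases Sym2.mem_iff.1 hz with rfl | rfl
    · exact h.fst_mem
    · exact h.snd_mem

lemma sparse_iff (H : (⊤ : SimpleGraph V).Subgraph) :
    SubSparse 2 3 H ↔ FSparse (FE H) (FV H) := by
  constructor
  · intro h S hS h2
    have hle : H.induce (S : Set V) ≤ H := by
      refine ⟨fun x hx => ?_, fun a b hab => ?_⟩
      · exact (mem_FV H x).1 (hS hx)
      · simp at hab
        exact hab.2.2
    have := h (H.induce (S : Set V)) hle (by simpa using h2)
    rw [card_FE] at this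
    have he : FE (H.induce (S : Set V)) = eIn (FE H) S := by
      ext e
      induction e using Sym2.ind with
      | _ x y =>
        rw [mem_eIn, mem_FE', mem_FE']
        simp
        tauto
    rw [he] at this
    simp at this
    omega
  · intro h H' hle h2
    rw [card_FV] at h2
    have h3 := h (FV H') (fun x hx => (mem_FV H x).2 (hle.1 ((mem_FV H' x).1 hx))) h2
    have h4 : FE H' ⊆ eIn (FE H) (FV H') := by
      intro e he
      rw [mem_eIn]
      refine ⟨?_, FE_in H' e he⟩
      rw [mem_FE] at *
      exact SimpleGraph.Subgraph.edgeSet_mono hle he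
    have := Finset.card_le_card h4
    rw [card_FE, card_FV]
    push_cast
    omega

lemma tight_iff (H : (⊤ : SimpleGraph V).Subgraph) :
    SubTight 2 3 H ↔ FSparse (FE H) (FV H) ∧ (FE H).card + 3 = 2 * (FV H).card := by
  unfold SubTight
  rw [sparse_iff, card_FE, card_FV]
  push_cast
  refine and_congr_right fun _ => ?_
  omega

lemma FSparse_congr (F F' : Finset (Sym2 V)) (W W' : Finset V) (hs : FSparse F W) (hW : W' ⊆ W)
    (h : ∀ S ⊆ W', eIn F' S ⊆ eIn F S) : FSparse F' W' := by
  intro S hS h2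
  have := hs S (hS.trans hW) h2
  have := Finset.card_le_card (h S hS)
  omega

/-- Reduced graph: delete `v` -/
def del (H : (⊤ : SimpleGraph V).Subgraph) (v : V) : (⊤ : SimpleGraph V).Subgraph where
  verts := {x | x ∈ H.verts ∧ x ≠ v}
  Adj a b := H.Adj a b ∧ a ≠ v ∧ b ≠ v
  adj_sub h := h.1.adj_sub
  edge_vert h := ⟨h.1.fst_mem, h.2.1⟩
  symm := ⟨fun _ _ h => ⟨h.1.symm, h.2.2, h.2.1⟩⟩

/-- Reduced graph: delete `v` and add the edge `pq` -/
def delAdd (H : (⊤ : SimpleGraph V).Subgraph) (v p q : V) (hpq : p ≠ q)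
    (hp : p ∈ H.verts ∧ p ≠ v) (hq : q ∈ H.verts ∧ q ≠ v) : (⊤ : SimpleGraph V).Subgraph where
  verts := {x | x ∈ H.verts ∧ x ≠ v}
  Adj a b := (H.Adj a b ∧ a ≠ v ∧ b ≠ v) ∨ (a = p ∧ b = q) ∨ (a = q ∧ b = p)
  adj_sub {a b} h := by
    have := fun h : H.Adj a b => h.adj_sub.ne
    rw [SimpleGraph.top_adj]
    grind
  edge_vert {a b} h := by
    rcases h with h | ⟨rfl, _⟩ | ⟨rfl, _⟩
    · exact ⟨h.1.fst_mem, h.2.1⟩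
    · exact hp
    · exact hq
  symm := ⟨fun a b h => by
    have := H.adj_comm a b
    grind⟩

lemma FV_del (H : (⊤ : SimpleGraph V).Subgraph) (v : V) : FV (del H v) = (FV H).erase v := by
  ext x
  rw [Finset.mem_erase, mem_FV, mem_FV]
  simp [del, and_comm]

lemma FE_del (H : (⊤ : SimpleGraph V).Subgraph) (v : V) :
    FE (del H v) = (FE H).filter (fun e => ¬ v ∈ e) := by
  ext e
  induction e using Sym2.ind with
  | _ x y =>
    rw [Finset.mem_filter, mem_FE', mem_FE']
    simp only [del, Sym2.mem_iff]
    grind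

lemma degree_card (H : (⊤ : SimpleGraph V).Subgraph) (v : V) :
    (Finset.univ.filter (fun w => H.Adj v w)).card = ((FE H).filter (fun e => v ∈ e)).card := by
  apply Finset.card_bij (fun w _ => s(v, w))
  · intro a ha
    rw [Finset.mem_filter, mem_FE']
    simpa using ha
  · intro a _ b _ h
    have h' : s(v, a) = s(v, b) := h
    rw [Sym2.eq_iff] at h'
    grind
  · intro e
    induction e using Sym2.ind with
    | _ x y =>
      intro h
      rw [Finset.mem_filter, mem_FE', Sym2.mem_iff] at h
      rcases h.2 with rfl | rfl
      · exact ⟨y, by simpa using h.1, rfl⟩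
      · exact ⟨x, by simpa using h.1.symm, Sym2.eq_swap⟩

lemma edge_case (G H : (⊤ : SimpleGraph V).Subgraph) (hle : G ≤ H) (hH : SubTight 2 3 H)
    (v p q r : V) (hvG : v ∉ G.verts) (hvH : v ∈ H.verts) (hpq : p ≠ q) (hpr : p ≠ r) (hqr : q ≠ r)
    (hN : ∀ w, H.Adj v w ↔ w = p ∨ w = q ∨ w = r)
    (hdeg : ((FE H).filter (fun e => v ∈ e)).card = 3)
    (hfree : FreePair (FE H) ((FV H).erase v) p q) :
    ∃ K, G ≤ K ∧ SubTight 2 3 K ∧ HennEdgeMove K H ∧ (FV K).card < (FV H).card := by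
  have ap := (hN p).2 (by simp)
  have aq := (hN q).2 (by simp)
  have ar := (hN r).2 (by simp)
  have hp : p ∈ H.verts ∧ p ≠ v := ⟨ap.snd_mem, ap.ne.symm⟩
  have hq : q ∈ H.verts ∧ q ≠ v := ⟨aq.snd_mem, aq.ne.symm⟩
  have hr : r ∈ H.verts ∧ r ≠ v := ⟨ar.snd_mem, ar.ne.symm⟩
  have hnadj : ¬ H.Adj p q := by
    intro h
    have h1 := hfree {p, q} (by
      intro x hx
      rw [Finset.mem_erase, mem_FV]
      simp only [Finset.mem_insert, Finset.mem_singleton] at hx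
      rcases hx with rfl | rfl
      · exact hp.symm
      · exact hq.symm) (by simp) (by simp)
    rw [Finset.card_pair hpq] at h1
    have : 0 < (eIn (FE H) {p, q}).card := Finset.card_pos.2 ⟨s(p, q), by
      rw [mem_eIn, mem_FE']
      exact ⟨h, by simp⟩⟩
    omega
  have hFE : FE (delAdd H v p q hpq hp hq) = insert s(p, q) (FE (del H v)) := by
    ext e
    induction e using Sym2.ind with
    | _ x y =>
      rw [Finset.mem_insert, mem_FE', mem_FE']
      simp only [del, delAdd, Sym2.eq_iff]
      tauto
  have hFV : FV (delAdd H v p q hpq hp hq) = (FV H).erase v := FV_del H v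
  have hnot : s(p, q) ∉ FE (del H v) := by
    rw [mem_FE']
    exact fun h => hnadj h.1
  have hvF : v ∈ FV H := (mem_FV H v).2 hvH
  have hcl : ((FV H).erase v).card + 1 = (FV H).card := Finset.card_erase_add_one hvF
  have hFc := Finset.card_filter_add_card_filter_not (s := FE H) (fun e => v ∈ e)
  rw [tight_iff] at hH
  obtain ⟨hs, hc⟩ := hH
  refine ⟨delAdd H v p q hpq hp hq, ?_, ?_, ?_, ?_⟩
  · refine ⟨fun x hx => ⟨hle.1 hx, fun h => hvG (h ▸ hx)⟩, fun a b hab => Or.inl ⟨hle.2 hab, ?_, ?_⟩⟩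
    · rintro rfl; exact hvG hab.fst_mem
    · rintro rfl; exact hvG hab.snd_mem
  · rw [tight_iff, hFE, hFV, Finset.card_insert_of_notMem hnot]
    constructor
    · intro S hS h2
      have h1 := hs S (hS.trans (Finset.erase_subset _ _)) h2
      by_cases hpqS : p ∈ S ∧ q ∈ S
      · have h3 := hfree S hS hpqS.1 hpqS.2
        have h4 : eIn (insert s(p, q) (FE (del H v))) S ⊆ insert s(p, q) (eIn (FE H) S) := by
          intro e he
          rw [mem_eIn, FE_del] at he
          rw [Finset.mem_insert, mem_eIn]
          simp only [Finset.mem_insert, Finset.mem_filter] at he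
          tauto
        have h5 := Finset.card_le_card h4
        have h6 := Finset.card_insert_le s(p, q) (eIn (FE H) S)
        omega
      · have h4 : eIn (insert s(p, q) (FE (del H v))) S ⊆ (eIn (FE H) S) := by
          intro e he
          rw [mem_eIn, FE_del] at he
          rw [mem_eIn]
          simp only [Finset.mem_insert, Finset.mem_filter] at he
          refine ⟨?_, he.2⟩
          rcases he.1 with rfl | h
          · exact absurd ⟨he.2 p (by simp), he.2 q (by simp)⟩ hpqS
          · exact h.1
        have h5 := Finset.card_le_card h4
        omega
    · rw [FE_del]
      omega
  · refine ⟨v, p, q, r, fun h => h.2 rfl, hp, hq, hr, Or.inr (Or.inl ⟨rfl, rfl⟩), hpr.symm,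
      hqr.symm, ?_, ?_⟩
    · ext x
      simp only [delAdd, Set.mem_insert_iff, Set.mem_ofPred_eq]
      grind
    · intro a b
      have h1 := hN a
      have h2 := hN b
      have h3 := H.adj_comm a b
      have h4 := H.adj_comm p q
      simp only [delAdd]
      by_cases hav : a = v
      · subst hav; grind
      · by_cases hbv : b = v
        · subst hbv; grind
        · grind
  · rw [hFV]; omega

lemma step (G H : (⊤ : SimpleGraph V).Subgraph) (hle : G ≤ H) (hG : SubTight 2 3 G)
    (hH : SubTight 2 3 H) (hne : G ≠ H) :
    ∃ K, G ≤ K ∧ SubTight 2 3 K ∧ (HennVertexMove K H ∨ HennEdgeMove K H) ∧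
      (FV K).card < (FV H).card := by
  have hH0 := hH
  rw [tight_iff] at hG hH
  obtain ⟨hsG, hcG⟩ := hG
  obtain ⟨hs, hc⟩ := hH
  have hVs : FV G ⊆ FV H := fun x hx => (mem_FV H x).2 (hle.1 ((mem_FV G x).1 hx))
  have hEs : FE G ⊆ FE H := fun x hx => (mem_FE H x).2
    (SimpleGraph.Subgraph.edgeSet_mono hle ((mem_FE G x).1 hx))
  have hVss : FV G ⊂ FV H := by
    refine hVs.ssubset_of_ne fun h => hne ?_
    have hE : FE G = FE H := Finset.eq_of_subset_of_card_le hEs (by rw [h] at hcG; omega)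
    apply SimpleGraph.Subgraph.ext
    · ext x; rw [← mem_FV, ← mem_FV, h]
    · ext a b; rw [← mem_FE', ← mem_FE', hE]
  have hG2 : 2 ≤ (FV G).card := by omega
  have hGe : eIn (FE H) (FV G) = FE G := by
    symm
    apply Finset.eq_of_subset_of_card_le
    · intro e he
      rw [mem_eIn]
      exact ⟨hEs he, FE_in G e he⟩
    · have := hs (FV G) hVs hG2
      omega
  obtain ⟨v, hv, hd⟩ := exists_low_degree (FE H) (FE_nd H) (FV H) (FV G) hs (FE_in H) hc hVss
    (by rw [hGe]; exact hcG)
  rw [Finset.mem_sdiff] at hv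
  have hvG : v ∉ G.verts := fun h => hv.2 ((mem_FV G v).2 h)
  have hvH : v ∈ H.verts := (mem_FV H v).1 hv.1
  have hlt := Finset.card_lt_card hVss
  have hcl : ((FV H).erase v).card + 1 = (FV H).card := Finset.card_erase_add_one hv.1
  have hFc := Finset.card_filter_add_card_filter_not (s := FE H) (fun e => v ∈ e)
  have hdel : eIn (FE H) ((FV H).erase v) = (FE H).filter (fun e => ¬ v ∈ e) := by
    ext e
    rw [mem_eIn, Finset.mem_filter]
    refine and_congr_right fun he => ?_
    have := FE_in H e he
    simp only [Finset.mem_erase]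
    grind
  have hd2 : 2 ≤ ((FE H).filter (fun e => v ∈ e)).card := by
    have := hs ((FV H).erase v) (Finset.erase_subset _ _) (by omega)
    rw [hdel] at this
    omega
  have hdc := degree_card H v
  rcases (show ((FE H).filter (fun e => v ∈ e)).card = 2 ∨
    ((FE H).filter (fun e => v ∈ e)).card = 3 by omega) with h2 | h3
  · have hN := hdc.trans h2
    rw [Finset.card_eq_two] at hN
    obtain ⟨p, q, hpq, hN⟩ := hN
    have hN : ∀ w, H.Adj v w ↔ w = p ∨ w = q := by
      intro w
      have := congrArg (fun s => w ∈ s) hN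
      simpa using this
    have ap := (hN p).2 (by simp)
    have aq := (hN q).2 (by simp)
    refine ⟨del H v, ?_, ?_, Or.inl ?_, ?_⟩
    · refine ⟨fun x hx => ⟨hle.1 hx, fun h => hvG (h ▸ hx)⟩, fun a b hab => ⟨hle.2 hab, ?_, ?_⟩⟩
      · rintro rfl; exact hvG hab.fst_mem
      · rintro rfl; exact hvG hab.snd_mem
    · rw [tight_iff, FV_del, FE_del]
      refine ⟨FSparse_congr _ _ _ _ hs (Finset.erase_subset _ _) ?_, by omega⟩
      intro S _ e he
      rw [mem_eIn, Finset.mem_filter] at he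
      rw [mem_eIn]
      exact ⟨he.1.1, he.2⟩
    · refine ⟨v, p, q, fun h => h.2 rfl, ⟨ap.snd_mem, ap.ne.symm⟩, ⟨aq.snd_mem, aq.ne.symm⟩,
        hpq, ?_, ?_⟩
      · ext x
        simp only [del, Set.mem_insert_iff, Set.mem_ofPred_eq]
        grind
      · intro a b
        have h1 := hN a
        have h2 := hN b
        have h3 := H.adj_comm a b
        simp only [del]
        by_cases hav : a = v
        · subst hav; grind
        · by_cases hbv : b = v
          · subst hbv; grind
          · grind
    · rw [FV_del]; omega
  · have hN := hdc.trans h3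
    rw [Finset.card_eq_three] at hN
    obtain ⟨p, q, r, hpq, hpr, hqr, hN⟩ := hN
    have hN : ∀ w, H.Adj v w ↔ w = p ∨ w = q ∨ w = r := by
      intro w
      have := congrArg (fun s => w ∈ s) hN
      simpa using this
    have ap := (mem_FE' H _ _).2 ((hN p).2 (by simp))
    have aq := (mem_FE' H _ _).2 ((hN q).2 (by simp))
    have ar := (mem_FE' H _ _).2 ((hN r).2 (by simp))
    have fin : ∃ K, G ≤ K ∧ SubTight 2 3 K ∧ HennEdgeMove K H ∧ (FV K).card < (FV H).card := by
      rcases exists_free (FE H) (FE_nd H) (FV H) hs v p q r hv.1 hpq hpr hqr ap aq ar with h | h | h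
      · exact edge_case G H hle hH0 v p q r hvG hvH hpq hpr hqr hN h3 h
      · exact edge_case G H hle hH0 v q r p hvG hvH hqr hpq.symm hpr.symm
          (fun w => by rw [hN]; tauto) h3 h
      · exact edge_case G H hle hH0 v p r q hvG hvH hpr hpq hqr.symm
          (fun w => by rw [hN]; tauto) h3 h
    obtain ⟨K, h1, h2, h3, h4⟩ := fin
    exact ⟨K, h1, h2, Or.inr h3, h4⟩

lemma chain_aux (G : (⊤ : SimpleGraph V).Subgraph) (hG : SubTight 2 3 G) (m : ℕ) :
    ∀ H : (⊤ : SimpleGraph V).Subgraph, G ≤ H → SubTight 2 3 H → (FV H).card ≤ m →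
    ∃ (n : ℕ) (c : ℕ → (⊤ : SimpleGraph V).Subgraph),
      c 0 = G ∧ c n = H ∧
      ∀ i < n, HennVertexMove (c i) (c (i + 1)) ∨ HennEdgeMove (c i) (c (i + 1)) := by
  induction m with
  | zero =>
    intro H _ hH h0
    rw [tight_iff] at hH
    omega
  | succ m ih =>
    intro H hle hH hm
    by_cases hne : G = H
    · exact ⟨0, fun _ => G, rfl, hne, fun i hi => absurd hi (Nat.not_lt_zero i)⟩
    · obtain ⟨K, h1, h2, h3, h4⟩ := step G H hle hG hH hne
      obtain ⟨n, c, c0, cn, hc⟩ := ih K h1 h2 (by omega)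
      refine ⟨n + 1, fun i => if i ≤ n then c i else H, by simp [c0], by simp, ?_⟩
      intro i hi
      by_cases hin : i < n
      · simp only [if_pos hin.le, if_pos (Nat.succ_le_of_lt hin)]
        exact hc i hin
      · obtain rfl : i = n := by omega
        simpa [cn] using h3

end Graph

theorem statement_10 {V : Type} [Fintype V]
    (G G' : (⊤ : SimpleGraph V).Subgraph) (hGG' : G ≤ G')
    (hG : SubTight 2 3 G) (hG' : SubTight 2 3 G') :
    ∃ (n : ℕ) (c : ℕ → (⊤ : SimpleGraph V).Subgraph),
      c 0 = G ∧ c n = G' ∧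
      ∀ i < n, HennVertexMove (c i) (c (i + 1)) ∨ HennEdgeMove (c i) (c (i + 1)) := by
  exact chain_aux G hG _ G' hGG' hG' le_rfl

end RigidityPaper
end
end
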